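/- arXiv:1706.03398 — 3 statements merged into one kernel-verified Lean document; each statement's English description precedes it below -/
import Mathlib

section
/- Let λ be the Lyapunov exponent of the i.i.d. random product of A and B. Then max{L₁, L₂, L_∞} ≤ 4λ ≤ min{U₁, U₂, U_∞}, where for k ∈ {1,2,∞}, L_k = Σ_{a,b=1}^∞ 2^{−a−b} log φ_k(a,b) and U_k = Σ_{a,b=1}^∞ 2^{−a−b} log ψ_k(a,b). -/
open Filter

noncomputable section

/-- `M_i = A_{i_N} ⋯ A_{i_1}`, where index value `0` selects `A` and `1` selects `B`. -/
def wordProd (A B : Matrix (Fin 2) (Fin 2) ℝ) (N : ℕ) (i : Fin N → Fin 2) :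
    Matrix (Fin 2) (Fin 2) ℝ :=
  ((List.ofFn fun k => if i k = 0 then A else B).reverse).prod

/-- The Euclidean norm on ℝ². -/
def nrm2 (x : Fin 2 → ℝ) : ℝ := Real.sqrt ((x 0) ^ 2 + (x 1) ^ 2)

def phi1 (α β : ℝ) (a b : ℕ) : ℝ := 1 + α / (1 + α) * (a + b * β + a * α * (b * β))

def phi2 (α β : ℝ) (a b : ℕ) : ℝ :=
  min (Real.sqrt ((1 + a * α * (b * β)) ^ 2 + (b : ℝ) ^ 2 * β ^ 2))
    (Real.sqrt ((α ^ 2 * (1 + a + a * α * (b * β)) ^ 2 + (1 + α * (b * β)) ^ 2) / (1 + α ^ 2)))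

def phiInf (α β : ℝ) (a b : ℕ) : ℝ := 1 + a * α * (b * β)

def psi1 (α β : ℝ) (a b : ℕ) : ℝ := 1 + b * β + a * α * (b * β)

def Cabc (α β : ℝ) (a b : ℕ) : ℝ := (a * α + b * β) ^ 2 + (a * α * (b * β)) ^ 2

def psi2 (α β : ℝ) (a b : ℕ) : ℝ :=
  Real.sqrt ((2 + Cabc α β a b + Real.sqrt (Cabc α β a b * (Cabc α β a b + 4))) / 2)

def psiInf (α β : ℝ) (a b : ℕ) : ℝ := 1 + a + a * α * (b * β)

/-- `Σ_{a,b=1}^∞ 2^{-a-b} log (f a b)`. -/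
def coneSum (f : ℕ → ℕ → ℝ) : ℝ :=
  ∑' (a : ℕ) (b : ℕ), ((2 : ℝ) ^ (a + b + 2))⁻¹ * Real.log (f (a + 1) (b + 1))


/-- Expected terminal value of `f` after `N` random letters. -/
def EE (α β : ℝ) (f : ℝ → ℝ → ℝ) : ℕ → ℝ → ℝ → ℝ
  | 0, x, y => f x y
  | N + 1, x, y => (EE α β f N x (α * x + y) + EE α β f N (x + β * y) y) / 2

lemma EE_neg (α β : ℝ) (f : ℝ → ℝ → ℝ) (N : ℕ) : ∀ x y,
    EE α β (fun x y => - f x y) N x y = - EE α β f N x y := by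
  induction N with
  | zero => intro x y; rfl
  | succ N ih => intro x y; simp only [EE, ih]; ring

lemma wordProd_cons (A B : Matrix (Fin 2) (Fin 2) ℝ) (N : ℕ) (c : Fin 2) (i : Fin N → Fin 2) :
    wordProd A B (N + 1) (Fin.cons c i) = wordProd A B N i * (if c = 0 then A else B) := by
  simp [wordProd, List.ofFn_succ]

lemma bridge (α β : ℝ) (N : ℕ) : ∀ x y : ℝ,
    ((2 : ℝ) ^ N)⁻¹ * ∑ i : Fin N → Fin 2,
      Real.log (nrm2 ((wordProd !![1, 0; α, 1] !![1, β; 0, 1] N i).mulVec ![x, y]))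
    = EE α β (fun x y => Real.log (nrm2 ![x, y])) N x y := by
  induction N with
  | zero =>
    intro x y
    simp [wordProd, EE]
  | succ N ih =>
    intro x y
    rw [← (Fin.consEquiv (fun _ : Fin (N + 1) => Fin 2)).sum_comp, Fintype.sum_prod_type,
      Fin.sum_univ_two]
    have hA : (!![1, 0; α, 1] : Matrix (Fin 2) (Fin 2) ℝ).mulVec ![x, y] = ![x, α * x + y] := by
      ext k; fin_cases k <;> simp [Matrix.mulVec, dotProduct, Fin.sum_univ_two]
    have hB : (!![1, β; 0, 1] : Matrix (Fin 2) (Fin 2) ℝ).mulVec ![x, y] = ![x + β * y, y] := by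
      ext k; fin_cases k <;> simp [Matrix.mulVec, dotProduct, Fin.sum_univ_two]
    have e1 : ∀ (c : Fin 2) (i : Fin N → Fin 2),
      (Fin.consEquiv (fun _ : Fin (N + 1) => Fin 2)) (c, i) = Fin.cons c i := fun _ _ => rfl
    simp only [e1, wordProd_cons, ← Matrix.mulVec_mulVec, if_true, hA, hB, one_ne_zero, if_false]
    rw [EE, ← ih, ← ih, pow_succ, mul_inv]
    ring

/-- The induction over the number of letters. -/
lemma core_induction (α β : ℝ) (hα : 1 ≤ α) (hβ : 1 ≤ β) (f u : ℝ → ℝ → ℝ) (G H1 : ℕ → ℕ → ℝ)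
    (H0 : ℕ → ℝ) (l K : ℝ)
    (h1 : ∀ a b, H1 a b = (G a b + H1 (a + 1) b) / 2)
    (h0 : ∀ b, H0 b = (H1 0 b + H0 (b + 1)) / 2)
    (hl : H0 0 = 4 * l)
    (hstep : ∀ (a b : ℕ) (x y : ℝ), 0 ≤ x → α * x ≤ y → 0 < y →
      u x y + G a b ≤ u (x + (b + 1) * β * y) (y + (a + 1) * α * (x + (b + 1) * β * y)))
    (hb0 : ∀ (b : ℕ) (x y : ℝ), 0 ≤ x → α * x ≤ y → 0 < y →
      u x y + H0 b - 4 * l ≤ f (x + (b + 1) * β * y) y + K)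
    (hb1 : ∀ (a b : ℕ) (x y : ℝ), 0 ≤ x → α * x ≤ y → 0 < y →
      u x y + H1 a b - 2 * l ≤
        f (x + (b + 1) * β * y) (y + (a + 1) * α * (x + (b + 1) * β * y)) + K) (N : ℕ) :
    (∀ (b : ℕ) (x y : ℝ), 0 ≤ x → α * x ≤ y → 0 < y →
      u x y + H0 b - 4 * l + N * l ≤ EE α β f N (x + (b + 1) * β * y) y + K) ∧
    (∀ (a b : ℕ) (x y : ℝ), 0 ≤ x → α * x ≤ y → 0 < y →
      u x y + H1 a b - 2 * l + N * l ≤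
        EE α β f N (x + (b + 1) * β * y) (y + (a + 1) * α * (x + (b + 1) * β * y)) + K) := by
  induction N with
  | zero =>
    refine ⟨fun b x y hx hxy hy => ?_, fun a b x y hx hxy hy => ?_⟩
    · simpa [EE] using hb0 b x y hx hxy hy
    · simpa [EE] using hb1 a b x y hx hxy hy
  | succ N ih =>
    obtain ⟨ih0, ih1⟩ := ih
    refine ⟨fun b x y hx hxy hy => ?_, fun a b x y hx hxy hy => ?_⟩
    · have k0 := ih0 (b + 1) x y hx hxy hy
      have k1 := ih1 0 b x y hx hxy hy
      have e0 : x + (((b + 1 : ℕ) : ℝ) + 1) * β * y = x + (b + 1) * β * y + β * y := by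
        push_cast; ring
      have e1 : y + (((0 : ℕ) : ℝ) + 1) * α * (x + (b + 1) * β * y) =
        α * (x + (b + 1) * β * y) + y := by
        push_cast; ring
      rw [e0] at k0
      rw [e1] at k1
      have := h0 b
      rw [EE]
      push_cast
      linarith
    · set x' := x + (b + 1) * β * y with hx'
      set y' := y + (a + 1) * α * x' with hy'
      have hx0 : 0 ≤ x' := by positivity
      have k1 := ih1 (a + 1) b x y hx hxy hy
      have hc : α * x' ≤ y' := by
        have : 0 ≤ a * α * x' := by positivity
        rw [hy']; nlinarith
      have hy0 : 0 < y' := by positivity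
      have k0 := ih0 0 x' y' hx0 hc hy0
      have ks := hstep a b x y hx hxy hy
      rw [← hx', ← hy'] at ks
      have e0 : x' + (((0 : ℕ) : ℝ) + 1) * β * y' = x' + β * y' := by
        push_cast; ring
      have e1 : y + (((a + 1 : ℕ) : ℝ) + 1) * α * x' = α * x' + y' := by
        rw [hy']; push_cast; ring
      rw [← hx', e1] at k1
      rw [e0] at k0
      have := h1 a b
      rw [EE]
      push_cast
      linarith

/-- Passing to the limit. -/
lemma core_limit (α β : ℝ) (hα : 1 ≤ α) (hβ : 1 ≤ β) (f u : ℝ → ℝ → ℝ) (G H1 : ℕ → ℕ → ℝ)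
    (H0 : ℕ → ℝ) (l K : ℝ)
    (h1 : ∀ a b, H1 a b = (G a b + H1 (a + 1) b) / 2)
    (h0 : ∀ b, H0 b = (H1 0 b + H0 (b + 1)) / 2)
    (hl : H0 0 = 4 * l)
    (hstep : ∀ (a b : ℕ) (x y : ℝ), 0 ≤ x → α * x ≤ y → 0 < y →
      u x y + G a b ≤ u (x + (b + 1) * β * y) (y + (a + 1) * α * (x + (b + 1) * β * y)))
    (hb0 : ∀ (b : ℕ) (x y : ℝ), 0 ≤ x → α * x ≤ y → 0 < y →
      u x y + H0 b - 4 * l ≤ f (x + (b + 1) * β * y) y + K)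
    (hb1 : ∀ (a b : ℕ) (x y : ℝ), 0 ≤ x → α * x ≤ y → 0 < y →
      u x y + H1 a b - 2 * l ≤
        f (x + (b + 1) * β * y) (y + (a + 1) * α * (x + (b + 1) * β * y)) + K)
    (lam : ℝ) (hlam : Tendsto (fun N : ℕ => ((N : ℝ))⁻¹ * EE α β f N 0 1) atTop (nhds lam)) :
    l ≤ lam := by
  obtain ⟨D, hD⟩ : ∃ D, ∀ N : ℕ, N * l - D ≤ EE α β f N 0 1 := by
    refine ⟨max (K - u 0 1 + 2 * l) (- f 0 1), fun N => ?_⟩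
    induction N with
    | zero =>
      simp only [EE]
      have := le_max_right (K - u 0 1 + 2 * l) (- f 0 1)
      push_cast
      linarith
    | succ N ih =>
      have k0 := (core_induction α β hα hβ f u G H1 H0 l K h1 h0 hl hstep hb0 hb1 N).1 0 0 1
        le_rfl (by simp) one_pos
      have := le_max_left (K - u 0 1 + 2 * l) (- f 0 1)
      rw [EE]
      simp only [Nat.cast_zero, zero_add, one_mul, mul_one, mul_zero] at k0 ⊢
      push_cast
      linarith
  have hD' : Tendsto (fun N : ℕ => l - D * ((N : ℝ))⁻¹) atTop (nhds l) := by
    simpa using tendsto_const_nhds.sub ((tendsto_inv_atTop_nhds_zero_nat (𝕜 := ℝ)).const_mul D)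
  refine le_of_tendsto_of_tendsto hD' hlam ?_
  filter_upwards [eventually_gt_atTop 0] with N hN
  have hN' : (0 : ℝ) < N := by exact_mod_cast hN
  have := mul_le_mul_of_nonneg_left (hD N) (inv_nonneg.2 hN'.le)
  have e : (N : ℝ)⁻¹ * (N * l - D) = l - D * (N : ℝ)⁻¹ := by field_simp
  linarith

def WG (G : ℕ → ℕ → ℝ) (p : ℕ × ℕ) : ℝ := ((2 : ℝ) ^ (p.1 + p.2 + 2))⁻¹ * G p.1 p.2

def HH1 (G : ℕ → ℕ → ℝ) (a b : ℕ) : ℝ := ∑' k : ℕ, ((2 : ℝ) ^ (k + 1))⁻¹ * G (a + k) b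

def HH0 (G : ℕ → ℕ → ℝ) (b : ℕ) : ℝ := ∑' j : ℕ, ((2 : ℝ) ^ (j + 1))⁻¹ * HH1 G 0 (b + j)

lemma summable_H1 (G : ℕ → ℕ → ℝ) (hG : Summable (WG G)) (a b : ℕ) :
    Summable (fun k : ℕ => ((2 : ℝ) ^ (k + 1))⁻¹ * G (a + k) b) := by
  have h1 : Summable (fun k : ℕ => WG G (k, b)) :=
    hG.comp_injective (i := fun k : ℕ => (k, b)) (fun x y h => (Prod.mk.inj h).1)
  have h2 := (((summable_nat_add_iff a).2 h1)).mul_left ((2 : ℝ) ^ (a + b + 1))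
  refine h2.congr (fun k => ?_)
  simp only [WG]
  rw [add_comm k a, ← mul_assoc]
  congr 1
  field_simp
  ring

lemma H1_zero (G : ℕ → ℕ → ℝ) (b : ℕ) :
    ((2 : ℝ) ^ (b + 1))⁻¹ * HH1 G 0 b = ∑' k, WG G (k, b) := by
  rw [HH1, ← tsum_mul_left]
  refine tsum_congr (fun k => ?_)
  simp only [WG, zero_add]
  rw [← mul_assoc]
  congr 1
  field_simp
  ring

lemma summable_H0 (G : ℕ → ℕ → ℝ) (hG : Summable (WG G)) (b : ℕ) :
    Summable (fun j : ℕ => ((2 : ℝ) ^ (j + 1))⁻¹ * HH1 G 0 (b + j)) := by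
  have h0 : Summable (fun p : ℕ × ℕ => WG G p.swap) := hG.prod_symm
  have h1 : Summable (fun j : ℕ => ∑' k, WG G (k, j)) := h0.prod
  have h2 := (((summable_nat_add_iff b).2 h1)).mul_left ((2 : ℝ) ^ b)
  refine h2.congr (fun j => ?_)
  rw [← H1_zero, add_comm j b, ← mul_assoc]
  congr 1
  field_simp
  ring

lemma H1_rec (G : ℕ → ℕ → ℝ) (hG : Summable (WG G)) (a b : ℕ) :
    HH1 G a b = (G a b + HH1 G (a + 1) b) / 2 := by
  rw [HH1, (summable_H1 G hG a b).tsum_eq_zero_add, HH1, add_div, div_eq_mul_inv (tsum _),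
    ← tsum_mul_right]
  congr 1
  · simp; ring
  · refine tsum_congr (fun k => ?_)
    rw [show a + (k + 1) = a + 1 + k by ring]
    field_simp
    ring

lemma H0_rec (G : ℕ → ℕ → ℝ) (hG : Summable (WG G)) (b : ℕ) :
    HH0 G b = (HH1 G 0 b + HH0 G (b + 1)) / 2 := by
  rw [HH0, (summable_H0 G hG b).tsum_eq_zero_add, HH0, add_div, div_eq_mul_inv (tsum _),
    ← tsum_mul_right]
  congr 1
  · simp; ring
  · refine tsum_congr (fun k => ?_)
    rw [show b + (k + 1) = b + 1 + k by ring]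
    field_simp
    ring

lemma H0_zero (G : ℕ → ℕ → ℝ) (hG : Summable (WG G)) : HH0 G 0 = ∑' p, WG G p := by
  have h0 : Summable (fun p : ℕ × ℕ => WG G p.swap) := hG.prod_symm
  rw [HH0, ← (Equiv.prodComm ℕ ℕ).tsum_eq, ]
  have : ∑' p, WG G ((Equiv.prodComm ℕ ℕ) p) = ∑' j, ∑' k, WG G (k, j) := h0.tsum_prod
  rw [this]
  refine tsum_congr (fun k => ?_)
  rw [zero_add, H1_zero]

lemma half_hasSum : HasSum (fun k : ℕ => ((2 : ℝ) ^ (k + 1))⁻¹) 1 := by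
  have h := hasSum_geometric_two' (1 : ℝ)
  have e : (fun k : ℕ => ((2 : ℝ) ^ (k + 1))⁻¹) = fun n : ℕ => (1 : ℝ) / 2 / 2 ^ n := by
    funext k
    rw [pow_succ]
    field_simp
  rw [e]
  exact h

lemma H1_le (G : ℕ → ℕ → ℝ) (hG : Summable (WG G)) (C : ℝ) (a b : ℕ)
    (h : ∀ k, G (a + k) b ≤ C) : HH1 G a b ≤ C := by
  have h2 := half_hasSum.mul_right C
  rw [one_mul] at h2
  rw [← h2.tsum_eq]
  exact (summable_H1 G hG a b).tsum_le_tsum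
    (fun k => mul_le_mul_of_nonneg_left (h k) (by positivity)) h2.summable

lemma le_H1 (G : ℕ → ℕ → ℝ) (hG : Summable (WG G)) (C : ℝ) (a b : ℕ)
    (h : ∀ k, C ≤ G (a + k) b) : C ≤ HH1 G a b := by
  have h2 := half_hasSum.mul_right C
  rw [one_mul] at h2
  rw [← h2.tsum_eq]
  exact h2.summable.tsum_le_tsum
    (fun k => mul_le_mul_of_nonneg_left (h k) (by positivity)) (summable_H1 G hG a b)

lemma H0_le (G : ℕ → ℕ → ℝ) (hG : Summable (WG G)) (C : ℝ) (b : ℕ)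
    (h : ∀ j, HH1 G 0 (b + j) ≤ C) : HH0 G b ≤ C := by
  have h2 := half_hasSum.mul_right C
  rw [one_mul] at h2
  rw [← h2.tsum_eq]
  exact (summable_H0 G hG b).tsum_le_tsum
    (fun k => mul_le_mul_of_nonneg_left (h k) (by positivity)) h2.summable

lemma le_H0 (G : ℕ → ℕ → ℝ) (hG : Summable (WG G)) (C : ℝ) (b : ℕ)
    (h : ∀ j, C ≤ HH1 G 0 (b + j)) : C ≤ HH0 G b := by
  have h2 := half_hasSum.mul_right C
  rw [one_mul] at h2
  rw [← h2.tsum_eq]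
  exact h2.summable.tsum_le_tsum
    (fun k => mul_le_mul_of_nonneg_left (h k) (by positivity)) (summable_H0 G hG b)

lemma coneSum_eq (f : ℕ → ℕ → ℝ) (h : Summable (WG fun a b => Real.log (f (a + 1) (b + 1)))) :
    coneSum f = ∑' p, WG (fun a b => Real.log (f (a + 1) (b + 1))) p := by
  rw [h.tsum_prod]
  rfl

lemma nrm2_mono {x y x' y' : ℝ} (hx : 0 ≤ x) (hy : 0 ≤ y) (hxx : x ≤ x') (hyy : y ≤ y') :
    nrm2 ![x, y] ≤ nrm2 ![x', y'] := by
  simp only [nrm2, Matrix.cons_val_zero, Matrix.cons_val_one]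
  gcongr

lemma nrm2_pos {x y : ℝ} (hy : 0 < y) : 0 < nrm2 ![x, y] := by
  simp only [nrm2, Matrix.cons_val_zero, Matrix.cons_val_one]
  positivity

lemma lower_fin (α β : ℝ) (hα : 1 ≤ α) (hβ : 1 ≤ β) (lam : ℝ)
    (hlam : Tendsto (fun N : ℕ => ((N : ℝ))⁻¹ *
      EE α β (fun x y => Real.log (nrm2 ![x, y])) N 0 1) atTop (nhds lam))
    (n : ℝ → ℝ → ℝ) (φ : ℕ → ℕ → ℝ)
    (hn : ∀ x y : ℝ, 0 ≤ x → α * x ≤ y → 0 < y → 0 < n x y ∧ n x y ≤ 2 * nrm2 ![x, y])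
    (hφ : ∀ a b : ℕ, 1 ≤ φ (a + 1) (b + 1))
    (hs : ∀ (a b : ℕ) (x y : ℝ), 0 ≤ x → α * x ≤ y → 0 < y → φ (a + 1) (b + 1) * n x y ≤
      n (x + (b + 1) * β * y) (y + (a + 1) * α * (x + (b + 1) * β * y)))
    (s : Finset (ℕ × ℕ)) :
    ∑ p ∈ s, WG (fun a b => Real.log (φ (a + 1) (b + 1))) p ≤ 4 * lam := by
  classical
  set g : ℕ → ℕ → ℝ := fun a b => Real.log (φ (a + 1) (b + 1)) with hg
  have hg0 : ∀ a b, 0 ≤ g a b := fun a b => Real.log_nonneg (hφ a b)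
  set G : ℕ → ℕ → ℝ := fun a b => if (a, b) ∈ s then g a b else 0 with hG
  have hGs : HasSum (WG G) (∑ p ∈ s, WG g p) := by
    have e : ∑ p ∈ s, WG g p = ∑ p ∈ s, WG G p := by
      refine Finset.sum_congr rfl (fun p hp => ?_)
      simp [WG, hG, hp]
    rw [e]
    refine hasSum_sum_of_ne_finset_zero (fun p hp => ?_)
    simp [WG, hG, hp]
  set C : ℝ := ∑ p ∈ s, g p.1 p.2 with hC
  have hC0 : 0 ≤ C := Finset.sum_nonneg (fun p _ => hg0 _ _)
  have hGC : ∀ a b, G a b ≤ C := by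
    intro a b
    by_cases h : (a, b) ∈ s
    · simp only [hG, h, if_true]
      exact Finset.single_le_sum (f := fun p : ℕ × ℕ => g p.1 p.2) (fun p _ => hg0 _ _) h
    · simpa [hG, h] using hC0
  have hGg : ∀ a b, G a b ≤ g a b := by
    intro a b
    by_cases h : (a, b) ∈ s
    · simp [hG, h]
    · simpa [hG, h] using hg0 a b
  have hl0 : 0 ≤ ∑ p ∈ s, WG g p :=
    Finset.sum_nonneg (fun p _ => mul_nonneg (by positivity) (hg0 _ _))
  have H1C : ∀ a b, HH1 G a b ≤ C := fun a b =>
    H1_le G hGs.summable C a b (fun k => hGC _ _)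
  have H0C : ∀ b, HH0 G b ≤ C := fun b =>
    H0_le G hGs.summable C b (fun k => H1C _ _)
  have base : ∀ x y x' y' : ℝ, 0 ≤ x → α * x ≤ y → 0 < y → x ≤ x' → y ≤ y' →
      Real.log (n x y) ≤ Real.log (nrm2 ![x', y']) + Real.log 2 := by
    intro x y x' y' hx hxy hy hxx hyy
    obtain ⟨p1, p2⟩ := hn x y hx hxy hy
    have m := nrm2_mono hx hy.le hxx hyy
    have q := nrm2_pos (x := x) hy
    rw [add_comm, ← Real.log_mul two_ne_zero (by linarith)]
    exact Real.log_le_log p1 (by linarith)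
  have := core_limit α β hα hβ (fun x y => Real.log (nrm2 ![x, y])) (fun x y => Real.log (n x y))
    G (HH1 G) (HH0 G) ((∑ p ∈ s, WG g p) / 4) (Real.log 2 + C) (H1_rec G hGs.summable)
    (H0_rec G hGs.summable) (by rw [H0_zero G hGs.summable, hGs.tsum_eq]; ring)
    (by
      intro a b x y hx hxy hy
      obtain ⟨p1, p2⟩ := hn x y hx hxy hy
      have q := hs a b x y hx hxy hy
      have r := hφ a b
      have := Real.log_le_log (by positivity) q
      rw [Real.log_mul (by positivity) (by positivity)] at this
      have := hGg a b
      simp only [hg] at this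
      linarith)
    (by
      intro b x y hx hxy hy
      have t : 0 ≤ (b + 1) * β * y := by positivity
      have := base x y (x + (b + 1) * β * y) y hx hxy hy (by linarith) le_rfl
      have := H0C b
      linarith)
    (by
      intro a b x y hx hxy hy
      have t : 0 ≤ (b + 1) * β * y := by positivity
      have t' : 0 ≤ (a + 1) * α * (x + (b + 1) * β * y) := by positivity
      have := base x y (x + (b + 1) * β * y) (y + (a + 1) * α * (x + (b + 1) * β * y))
        hx hxy hy (by linarith) (by linarith)
      have := H1C a b
      linarith)
    lam hlam
  linarith

lemma lower_bound (α β : ℝ) (hα : 1 ≤ α) (hβ : 1 ≤ β) (lam : ℝ)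
    (hlam : Tendsto (fun N : ℕ => ((N : ℝ))⁻¹ *
      EE α β (fun x y => Real.log (nrm2 ![x, y])) N 0 1) atTop (nhds lam))
    (n : ℝ → ℝ → ℝ) (φ : ℕ → ℕ → ℝ)
    (hn : ∀ x y : ℝ, 0 ≤ x → α * x ≤ y → 0 < y → 0 < n x y ∧ n x y ≤ 2 * nrm2 ![x, y])
    (hφ : ∀ a b : ℕ, 1 ≤ φ (a + 1) (b + 1))
    (hs : ∀ (a b : ℕ) (x y : ℝ), 0 ≤ x → α * x ≤ y → 0 < y → φ (a + 1) (b + 1) * n x y ≤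
      n (x + (b + 1) * β * y) (y + (a + 1) * α * (x + (b + 1) * β * y))) :
    coneSum φ ≤ 4 * lam := by
  have h := lower_fin α β hα hβ lam hlam n φ hn hφ hs
  have h0 : ∀ p, 0 ≤ WG (fun a b => Real.log (φ (a + 1) (b + 1))) p := fun p =>
    mul_nonneg (by positivity) (Real.log_nonneg (hφ _ _))
  rw [coneSum_eq φ (summable_of_sum_le h0 h)]
  exact Real.tsum_le_of_sum_le h0 h

lemma summable_of_growth (ψ : ℕ → ℕ → ℝ) (D : ℝ) (h1 : ∀ a b : ℕ, 1 ≤ ψ (a + 1) (b + 1))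
    (hD : ∀ a b : ℕ, ψ (a + 1) (b + 1) ≤ D * ((a + 1) * (b + 1))) :
    Summable (WG fun a b => Real.log (ψ (a + 1) (b + 1))) := by
  have s0 : Summable (fun k : ℕ => ((k : ℝ) + 1) * ((2 : ℝ) ^ (k + 1))⁻¹) := by
    have := summable_pow_mul_geometric_of_norm_lt_one (R := ℝ) 1 (r := 1 / 2) (by norm_num)
    have := (summable_nat_add_iff 1).2 this
    refine this.congr (fun k => ?_)
    push_cast
    rw [pow_one, one_div, inv_pow]
  have s1 := (s0.mul_of_nonneg s0 (fun k => by positivity) (fun k => by positivity)).mul_left D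
  refine Summable.of_nonneg_of_le (fun p => mul_nonneg (by positivity)
    (Real.log_nonneg (h1 _ _))) (fun p => ?_) s1
  have e : D * (((p.1 : ℝ) + 1) * ((2 : ℝ) ^ (p.1 + 1))⁻¹ *
      (((p.2 : ℝ) + 1) * ((2 : ℝ) ^ (p.2 + 1))⁻¹)) =
      ((2 : ℝ) ^ (p.1 + p.2 + 2))⁻¹ * (D * ((p.1 + 1) * (p.2 + 1))) := by
    field_simp
    ring
  rw [e, WG]
  refine mul_le_mul_of_nonneg_left (le_trans ?_ (hD _ _)) (by positivity)
  have := Real.log_le_sub_one_of_pos (lt_of_lt_of_le one_pos (h1 p.1 p.2))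
  linarith

lemma upper_bound (α β : ℝ) (hα : 1 ≤ α) (hβ : 1 ≤ β) (lam : ℝ)
    (hlam : Tendsto (fun N : ℕ => ((N : ℝ))⁻¹ *
      EE α β (fun x y => Real.log (nrm2 ![x, y])) N 0 1) atTop (nhds lam))
    (n : ℝ → ℝ → ℝ) (ψ : ℕ → ℕ → ℝ) (D : ℝ)
    (hn : ∀ x y : ℝ, 0 ≤ x → α * x ≤ y → 0 < y → 0 < n x y ∧ nrm2 ![x, y] ≤ 2 * n x y)
    (h1 : ∀ a b : ℕ, 1 ≤ ψ (a + 1) (b + 1))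
    (hD : ∀ a b : ℕ, ψ (a + 1) (b + 1) ≤ D * ((a + 1) * (b + 1)))
    (hm : ∀ a b a' b' : ℕ, a ≤ a' → b ≤ b' → ψ a b ≤ ψ a' b')
    (hs : ∀ (a b : ℕ) (x y : ℝ), 0 ≤ x → α * x ≤ y → 0 < y →
      n (x + (b + 1) * β * y) (y + (a + 1) * α * (x + (b + 1) * β * y))
        ≤ ψ (a + 1) (b + 1) * n x y) :
    4 * lam ≤ coneSum ψ := by
  have hS := summable_of_growth ψ D h1 hD
  rw [coneSum_eq ψ hS]
  set g : ℕ → ℕ → ℝ := fun a b => Real.log (ψ (a + 1) (b + 1)) with hg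
  set G : ℕ → ℕ → ℝ := fun a b => - g a b with hG
  have e : WG G = fun p => - WG g p := by
    funext p
    simp [WG, hG]
  have hGs : Summable (WG G) := by rw [e]; exact hS.neg
  have ht : ∑' p, WG G p = - ∑' p, WG g p := by rw [e, tsum_neg]
  have gm : ∀ a b a' b' : ℕ, a ≤ a' → b ≤ b' → G a' b' ≤ G a b := by
    intro a b a' b' ha hb
    simp only [hG, hg, neg_le_neg_iff]
    exact Real.log_le_log (by linarith [h1 a b]) (hm _ _ _ _ (by omega) (by omega))
  have H1C : ∀ a b, HH1 G a b ≤ G a b := fun a b =>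
    H1_le G hGs _ a b (fun k => gm _ _ _ _ (by omega) le_rfl)
  have H0C : ∀ b, HH0 G b ≤ G 0 b := fun b =>
    H0_le G hGs _ b (fun k => (H1C _ _).trans (gm _ _ _ _ le_rfl (by omega)))
  set l : ℝ := (∑' p, WG G p) / 4 with hl
  have la := neg_abs_le l
  have la0 := abs_nonneg l
  have coneX : ∀ (a b : ℕ) (x y : ℝ), 0 ≤ x → α * x ≤ y → 0 < y →
      0 ≤ x + (b + 1) * β * y ∧
      α * (x + (b + 1) * β * y) ≤ y + (a + 1) * α * (x + (b + 1) * β * y) ∧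
      0 < y + (a + 1) * α * (x + (b + 1) * β * y) := by
    intro a b x y hx hxy hy
    have t : 0 ≤ x + (b + 1) * β * y := by positivity
    have t' : 0 ≤ a * α * (x + (b + 1) * β * y) := by positivity
    refine ⟨t, by nlinarith, by positivity⟩
  have step : ∀ (a b : ℕ) (x y : ℝ), 0 ≤ x → α * x ≤ y → 0 < y →
      Real.log (n (x + (b + 1) * β * y) (y + (a + 1) * α * (x + (b + 1) * β * y)))
        ≤ Real.log (n x y) - G a b := by
    intro a b x y hx hxy hy
    obtain ⟨c1, c2, c3⟩ := coneX a b x y hx hxy hy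
    obtain ⟨p1, p2⟩ := hn x y hx hxy hy
    obtain ⟨q1, q2⟩ := hn _ _ c1 c2 c3
    have r := h1 a b
    have := Real.log_le_log q1 (hs a b x y hx hxy hy)
    rw [Real.log_mul (by positivity) (by positivity)] at this
    simp only [hG, hg]
    linarith
  have base : ∀ (a b : ℕ) (x y : ℝ), 0 ≤ x → α * x ≤ y → 0 < y →
      Real.log (nrm2 ![x + (b + 1) * β * y, y + (a + 1) * α * (x + (b + 1) * β * y)])
        ≤ Real.log 2 + Real.log (n x y) - G a b := by
    intro a b x y hx hxy hy
    obtain ⟨c1, c2, c3⟩ := coneX a b x y hx hxy hy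
    obtain ⟨q1, q2⟩ := hn _ _ c1 c2 c3
    have := Real.log_le_log (nrm2_pos c3) q2
    rw [Real.log_mul (by positivity) (by positivity)] at this
    have := step a b x y hx hxy hy
    linarith
  have := core_limit α β hα hβ (fun x y => - Real.log (nrm2 ![x, y]))
    (fun x y => - Real.log (n x y))
    G (HH1 G) (HH0 G) l (Real.log 2 + 4 * |l|) (H1_rec G hGs)
    (H0_rec G hGs) (by rw [H0_zero G hGs, hl]; ring)
    (by
      intro a b x y hx hxy hy
      have := step a b x y hx hxy hy
      linarith)
    (by
      intro b x y hx hxy hy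
      have := base 0 b x y hx hxy hy
      have t : 0 ≤ (b + 1) * β * y := by positivity
      have t' : 0 ≤ (((0 : ℕ) : ℝ) + 1) * α * (x + (b + 1) * β * y) := by positivity
      have m := nrm2_mono (x := x + (b + 1) * β * y) (y := y) (x' := x + (b + 1) * β * y)
        (y' := y + (((0 : ℕ) : ℝ) + 1) * α * (x + (b + 1) * β * y)) (by linarith) hy.le le_rfl
        (by linarith)
      have m' := Real.log_le_log (nrm2_pos hy) m
      have := H0C b
      linarith)
    (by
      intro a b x y hx hxy hy
      have := base a b x y hx hxy hy
      have := H1C a b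
      linarith)
    (-lam) (by
      simp only [EE_neg, mul_neg]
      exact hlam.neg)
  linarith

lemma nrm2_le_add {x y : ℝ} (hx : 0 ≤ x) (hy : 0 ≤ y) : nrm2 ![x, y] ≤ x + y := by
  simp only [nrm2, Matrix.cons_val_zero, Matrix.cons_val_one]
  exact Real.sqrt_le_iff.2 ⟨by positivity, by nlinarith [mul_nonneg hx hy]⟩

lemma fst_le_nrm2 {x y : ℝ} : x ≤ nrm2 ![x, y] := by
  simp only [nrm2, Matrix.cons_val_zero, Matrix.cons_val_one]
  exact Real.le_sqrt_of_sq_le (by nlinarith [sq_nonneg y])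

lemma snd_le_nrm2 {x y : ℝ} : y ≤ nrm2 ![x, y] := by
  simp only [nrm2, Matrix.cons_val_zero, Matrix.cons_val_one]
  exact Real.le_sqrt_of_sq_le (by nlinarith [sq_nonneg x])

lemma lower_phi1 (α β : ℝ) (hα : 1 ≤ α) (hβ : 1 ≤ β) (lam : ℝ)
    (hlam : Tendsto (fun N : ℕ => ((N : ℝ))⁻¹ *
      EE α β (fun x y => Real.log (nrm2 ![x, y])) N 0 1) atTop (nhds lam)) :
    coneSum (phi1 α β) ≤ 4 * lam := by
  refine lower_bound α β hα hβ lam hlam (fun x y => x + y) _ ?_ ?_ ?_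
  · intro x y hx hxy hy
    have h1 := fst_le_nrm2 (x := x) (y := y)
    have h2 := snd_le_nrm2 (x := x) (y := y)
    exact ⟨by positivity, by linarith⟩
  · intro a b
    rw [phi1]
    have : 0 ≤ α / (1 + α) * (((a + 1 : ℕ) : ℝ) + ((b + 1 : ℕ) : ℝ) * β +
      ((a + 1 : ℕ) : ℝ) * α * (((b + 1 : ℕ) : ℝ) * β)) := by positivity
    linarith
  · intro a b x y hx hxy hy
    rw [phi1]
    have ha : (1 : ℝ) ≤ (a : ℝ) + 1 := by linarith [Nat.cast_nonneg (α := ℝ) a]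
    have hb : (1 : ℝ) ≤ (b : ℝ) + 1 := by linarith [Nat.cast_nonneg (α := ℝ) b]
    push_cast
    generalize (a : ℝ) + 1 = r at *
    generalize (b : ℝ) + 1 = s at *
    have hp : 1 ≤ r * α := one_le_mul_of_one_le_of_one_le ha hα
    have ht : 1 ≤ s * β := one_le_mul_of_one_le_of_one_le hb hβ
    have h1 : 0 ≤ (y - α * x) * (s * β + r * α * (s * β) - r * α) :=
      mul_nonneg (by linarith) (by nlinarith)
    have h2 : x + s * β * y + (y + r * α * (x + s * β * y)) -
      (1 + α / (1 + α) * (r + s * β + r * α * (s * β))) * (x + y) =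
      (y - α * x) * (s * β + r * α * (s * β) - r * α) / (1 + α) := by
      field_simp
      ring
    have h3 := div_nonneg h1 (show 0 ≤ 1 + α by linarith)
    linarith

lemma lower_phi2 (α β : ℝ) (hα : 1 ≤ α) (hβ : 1 ≤ β) (lam : ℝ)
    (hlam : Tendsto (fun N : ℕ => ((N : ℝ))⁻¹ *
      EE α β (fun x y => Real.log (nrm2 ![x, y])) N 0 1) atTop (nhds lam)) :
    coneSum (phi2 α β) ≤ 4 * lam := by
  refine lower_bound α β hα hβ lam hlam (fun x y => nrm2 ![x, y]) _ ?_ ?_ ?_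
  · intro x y hx hxy hy
    have h1 := nrm2_pos (x := x) hy
    exact ⟨h1, by linarith⟩
  · intro a b
    rw [phi2]
    have ha : (1 : ℝ) ≤ (a : ℝ) + 1 := by linarith [Nat.cast_nonneg (α := ℝ) a]
    have hb : (1 : ℝ) ≤ (b : ℝ) + 1 := by linarith [Nat.cast_nonneg (α := ℝ) b]
    push_cast
    generalize (a : ℝ) + 1 = r at *
    generalize (b : ℝ) + 1 = s at *
    have hp : 1 ≤ r * α := one_le_mul_of_one_le_of_one_le ha hα
    have ht : 1 ≤ s * β := one_le_mul_of_one_le_of_one_le hb hβ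
    have hpt := one_le_mul_of_one_le_of_one_le hp ht
    refine le_min ?_ ?_
    · refine Real.le_sqrt_of_sq_le ?_
      nlinarith [mul_nonneg (sq_nonneg s) (sq_nonneg β)]
    · refine Real.le_sqrt_of_sq_le ?_
      rw [one_pow, le_div_iff₀ (by positivity)]
      have h1 : α ^ 2 * 1 ≤ α ^ 2 * (1 + r + r * α * (s * β)) ^ 2 :=
        mul_le_mul_of_nonneg_left (by nlinarith) (by positivity)
      have h2 : 0 ≤ α * (s * β) := by positivity
      nlinarith
  · intro a b x y hx hxy hy
    rw [phi2]
    have ha : (1 : ℝ) ≤ (a : ℝ) + 1 := by linarith [Nat.cast_nonneg (α := ℝ) a]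
    have hb : (1 : ℝ) ≤ (b : ℝ) + 1 := by linarith [Nat.cast_nonneg (α := ℝ) b]
    push_cast
    generalize (a : ℝ) + 1 = r at *
    generalize (b : ℝ) + 1 = s at *
    have hp : 1 ≤ r * α := one_le_mul_of_one_le_of_one_le ha hα
    have ht : 1 ≤ s * β := one_le_mul_of_one_le_of_one_le hb hβ
    set p := r * α with hpdef
    set t := s * β with htdef
    set m := min (Real.sqrt ((1 + p * t) ^ 2 + s ^ 2 * β ^ 2))
      (Real.sqrt ((α ^ 2 * (1 + r + p * t) ^ 2 + (1 + α * t) ^ 2) / (1 + α ^ 2))) with hm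
    have m0 : 0 ≤ m := le_min (Real.sqrt_nonneg _) (Real.sqrt_nonneg _)
    have mP : m ^ 2 ≤ (1 + p * t) ^ 2 + t ^ 2 := by
      calc m ^ 2 ≤ (Real.sqrt ((1 + p * t) ^ 2 + s ^ 2 * β ^ 2)) ^ 2 := by
            gcongr; exact min_le_left _ _
        _ = (1 + p * t) ^ 2 + t ^ 2 := by
            rw [Real.sq_sqrt (by positivity), htdef]; ring
    have mQ : m ^ 2 * (1 + α ^ 2) ≤ α ^ 2 * (1 + r + p * t) ^ 2 + (1 + α * t) ^ 2 := by
      rw [← le_div_iff₀ (by positivity)]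
      calc m ^ 2 ≤ (Real.sqrt ((α ^ 2 * (1 + r + p * t) ^ 2 + (1 + α * t) ^ 2) / (1 + α ^ 2))) ^ 2
          := by
            gcongr; exact min_le_right _ _
        _ = _ := Real.sq_sqrt (by positivity)
    have hQ : α ^ 2 * (1 + r + p * t) ^ 2 = (α + p + α * p * t) ^ 2 := by rw [hpdef]; ring
    rw [hQ] at mQ
    obtain ⟨z, hz⟩ : ∃ z, z = y - α * x := ⟨_, rfl⟩
    have hz0 : 0 ≤ z := by linarith
    obtain rfl : y = α * x + z := by linarith
    have mc : m ^ 2 * α ≤ (1 + α * t) * t + (α + p + α * p * t) * (1 + p * t) := by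
      have h1 : m ^ 2 * α ≤ ((1 + p * t) ^ 2 + t ^ 2) * α := by gcongr
      have h2 : 0 ≤ t + p * (1 + p * t) := by positivity
      nlinarith
    simp only [nrm2, Matrix.cons_val_zero, Matrix.cons_val_one]
    refine Real.le_sqrt_of_sq_le ?_
    rw [mul_pow, Real.sq_sqrt (by positivity)]
    have k1 := mul_le_mul_of_nonneg_left mQ (sq_nonneg x)
    have k2 := mul_le_mul_of_nonneg_left mP (sq_nonneg z)
    have k3 := mul_le_mul_of_nonneg_left mc (mul_nonneg hx hz0)
    nlinarith

lemma lower_phiInf (α β : ℝ) (hα : 1 ≤ α) (hβ : 1 ≤ β) (lam : ℝ)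
    (hlam : Tendsto (fun N : ℕ => ((N : ℝ))⁻¹ *
      EE α β (fun x y => Real.log (nrm2 ![x, y])) N 0 1) atTop (nhds lam)) :
    coneSum (phiInf α β) ≤ 4 * lam := by
  refine lower_bound α β hα hβ lam hlam (fun _ y => y) _ ?_ ?_ ?_
  · intro x y hx hxy hy
    have h2 := snd_le_nrm2 (x := x) (y := y)
    exact ⟨hy, by linarith⟩
  · intro a b
    rw [phiInf]
    have : 0 ≤ ((a + 1 : ℕ) : ℝ) * α * (((b + 1 : ℕ) : ℝ) * β) := by positivity
    linarith
  · intro a b x y hx hxy hy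
    rw [phiInf]
    have ha : (1 : ℝ) ≤ (a : ℝ) + 1 := by linarith [Nat.cast_nonneg (α := ℝ) a]
    have hb : (1 : ℝ) ≤ (b : ℝ) + 1 := by linarith [Nat.cast_nonneg (α := ℝ) b]
    push_cast
    generalize (a : ℝ) + 1 = r at *
    generalize (b : ℝ) + 1 = s at *
    have hp : 1 ≤ r * α := one_le_mul_of_one_le_of_one_le ha hα
    have ht : 1 ≤ s * β := one_le_mul_of_one_le_of_one_le hb hβ
    have : 0 ≤ r * α * x := by positivity
    nlinarith

lemma upper_psi1 (α β : ℝ) (hα : 1 ≤ α) (hβ : 1 ≤ β) (lam : ℝ)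
    (hlam : Tendsto (fun N : ℕ => ((N : ℝ))⁻¹ *
      EE α β (fun x y => Real.log (nrm2 ![x, y])) N 0 1) atTop (nhds lam)) :
    4 * lam ≤ coneSum (psi1 α β) := by
  refine upper_bound α β hα hβ lam hlam (fun x y => x + y) _ (3 * α * β) ?_ ?_ ?_ ?_ ?_
  · intro x y hx hxy hy
    have h1 := nrm2_le_add hx hy.le
    exact ⟨by positivity, by linarith⟩
  · intro a b
    rw [psi1]
    have : 0 ≤ ((b + 1 : ℕ) : ℝ) * β + ((a + 1 : ℕ) : ℝ) * α * (((b + 1 : ℕ) : ℝ) * β) := by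
      positivity
    linarith
  · intro a b
    rw [psi1]
    have ha : (1 : ℝ) ≤ (a : ℝ) + 1 := by linarith [Nat.cast_nonneg (α := ℝ) a]
    have hb : (1 : ℝ) ≤ (b : ℝ) + 1 := by linarith [Nat.cast_nonneg (α := ℝ) b]
    push_cast
    generalize (a : ℝ) + 1 = r at *
    generalize (b : ℝ) + 1 = s at *
    have hp : 1 ≤ r * α := one_le_mul_of_one_le_of_one_le ha hα
    have ht : 1 ≤ s * β := one_le_mul_of_one_le_of_one_le hb hβ
    have hpt := one_le_mul_of_one_le_of_one_le hp ht
    have : s * β ≤ r * α * (s * β) := by nlinarith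
    nlinarith
  · intro a b a' b' ha hb
    simp only [psi1]
    gcongr
  · intro a b x y hx hxy hy
    rw [psi1]
    have ha : (1 : ℝ) ≤ (a : ℝ) + 1 := by linarith [Nat.cast_nonneg (α := ℝ) a]
    have hb : (1 : ℝ) ≤ (b : ℝ) + 1 := by linarith [Nat.cast_nonneg (α := ℝ) b]
    push_cast
    generalize (a : ℝ) + 1 = r at *
    generalize (b : ℝ) + 1 = s at *
    have hp : 1 ≤ r * α := one_le_mul_of_one_le_of_one_le ha hα
    have ht : 1 ≤ s * β := one_le_mul_of_one_le_of_one_le hb hβ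
    have : 0 ≤ (s * β + r * α * (s * β) - r * α) * x :=
      mul_nonneg (by nlinarith) hx
    nlinarith

lemma upper_psiInf (α β : ℝ) (hα : 1 ≤ α) (hβ : 1 ≤ β) (lam : ℝ)
    (hlam : Tendsto (fun N : ℕ => ((N : ℝ))⁻¹ *
      EE α β (fun x y => Real.log (nrm2 ![x, y])) N 0 1) atTop (nhds lam)) :
    4 * lam ≤ coneSum (psiInf α β) := by
  refine upper_bound α β hα hβ lam hlam (fun _ y => y) _ (3 * α * β) ?_ ?_ ?_ ?_ ?_
  · intro x y hx hxy hy
    have h1 := nrm2_le_add hx hy.le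
    exact ⟨by positivity, by nlinarith⟩
  · intro a b
    rw [psiInf]
    have : 0 ≤ ((a + 1 : ℕ) : ℝ) + ((a + 1 : ℕ) : ℝ) * α * (((b + 1 : ℕ) : ℝ) * β) := by
      positivity
    linarith
  · intro a b
    rw [psiInf]
    have ha : (1 : ℝ) ≤ (a : ℝ) + 1 := by linarith [Nat.cast_nonneg (α := ℝ) a]
    have hb : (1 : ℝ) ≤ (b : ℝ) + 1 := by linarith [Nat.cast_nonneg (α := ℝ) b]
    push_cast
    generalize (a : ℝ) + 1 = r at *
    generalize (b : ℝ) + 1 = s at *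
    have hp : 1 ≤ r * α := one_le_mul_of_one_le_of_one_le ha hα
    have ht : 1 ≤ s * β := one_le_mul_of_one_le_of_one_le hb hβ
    have hpt := one_le_mul_of_one_le_of_one_le hp ht
    have : r ≤ r * α := by nlinarith
    have : r * α ≤ r * α * (s * β) := by nlinarith
    nlinarith
  · intro a b a' b' ha hb
    simp only [psiInf]
    gcongr
  · intro a b x y hx hxy hy
    rw [psiInf]
    have ha : (1 : ℝ) ≤ (a : ℝ) + 1 := by linarith [Nat.cast_nonneg (α := ℝ) a]
    have hb : (1 : ℝ) ≤ (b : ℝ) + 1 := by linarith [Nat.cast_nonneg (α := ℝ) b]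
    push_cast
    generalize (a : ℝ) + 1 = r at *
    generalize (b : ℝ) + 1 = s at *
    have hp : 1 ≤ r * α := one_le_mul_of_one_le_of_one_le ha hα
    have ht : 1 ≤ s * β := one_le_mul_of_one_le_of_one_le hb hβ
    have : r * (α * x) ≤ r * y := by gcongr
    nlinarith

lemma psi2_sq_bounds (c : ℝ) (hc : 0 ≤ c) : ∃ S, S = (2 + c + Real.sqrt (c * (c + 4))) / 2 ∧
    S ^ 2 - (2 + c) * S + 1 = 0 ∧ (2 + c) / 2 ≤ S ∧ S ≤ 2 + c := by
  have h := Real.sq_sqrt (show 0 ≤ c * (c + 4) by positivity)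
  have h0 := Real.sqrt_nonneg (c * (c + 4))
  have h1 : Real.sqrt (c * (c + 4)) ≤ c + 2 :=
    Real.sqrt_le_iff.2 ⟨by positivity, by nlinarith⟩
  exact ⟨_, rfl, by nlinarith, by linarith, by linarith⟩

lemma upper_psi2 (α β : ℝ) (hα : 1 ≤ α) (hβ : 1 ≤ β) (lam : ℝ)
    (hlam : Tendsto (fun N : ℕ => ((N : ℝ))⁻¹ *
      EE α β (fun x y => Real.log (nrm2 ![x, y])) N 0 1) atTop (nhds lam)) :
    4 * lam ≤ coneSum (psi2 α β) := by
  refine upper_bound α β hα hβ lam hlam (fun x y => nrm2 ![x, y]) _ (3 * α * β) ?_ ?_ ?_ ?_ ?_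
  · intro x y hx hxy hy
    have h1 := nrm2_pos (x := x) hy
    exact ⟨h1, by linarith⟩
  · intro a b
    have hc : 0 ≤ Cabc α β (a + 1) (b + 1) := by rw [Cabc]; positivity
    rw [psi2]
    obtain ⟨S, hS, h1, h2, h3⟩ := psi2_sq_bounds _ hc
    rw [← hS]
    exact Real.le_sqrt_of_sq_le (by linarith)
  · intro a b
    have hc : 0 ≤ Cabc α β (a + 1) (b + 1) := by rw [Cabc]; positivity
    rw [psi2]
    obtain ⟨S, hS, h1, h2, h3⟩ := psi2_sq_bounds _ hc
    rw [← hS]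
    refine Real.sqrt_le_iff.2 ⟨by positivity, h3.trans ?_⟩
    rw [Cabc]
    have ha : (1 : ℝ) ≤ (a : ℝ) + 1 := by linarith [Nat.cast_nonneg (α := ℝ) a]
    have hb : (1 : ℝ) ≤ (b : ℝ) + 1 := by linarith [Nat.cast_nonneg (α := ℝ) b]
    push_cast
    generalize (a : ℝ) + 1 = r at *
    generalize (b : ℝ) + 1 = s at *
    have hp : 1 ≤ r * α := one_le_mul_of_one_le_of_one_le ha hα
    have ht : 1 ≤ s * β := one_le_mul_of_one_le_of_one_le hb hβ
    have hpt := one_le_mul_of_one_le_of_one_le hp ht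
    have e : 3 * α * β * (r * s) = 3 * (r * α * (s * β)) := by ring
    rw [e]
    generalize r * α = p at *
    generalize s * β = t at *
    have : p + t ≤ 2 * (p * t) := by nlinarith
    have : (p + t) ^ 2 ≤ (2 * (p * t)) ^ 2 := by gcongr
    nlinarith
  · intro a b a' b' ha hb
    simp only [psi2, Cabc]
    gcongr
  · intro a b x y hx hxy hy
    have hc : 0 ≤ Cabc α β (a + 1) (b + 1) := by rw [Cabc]; positivity
    rw [psi2]
    obtain ⟨S, hS, h1, h2, h3⟩ := psi2_sq_bounds _ hc
    rw [← hS]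
    clear hS h3
    rw [Cabc] at h1 h2 hc
    push_cast at h1 h2 hc
    have ha : (1 : ℝ) ≤ (a : ℝ) + 1 := by linarith [Nat.cast_nonneg (α := ℝ) a]
    have hb : (1 : ℝ) ≤ (b : ℝ) + 1 := by linarith [Nat.cast_nonneg (α := ℝ) b]
    push_cast
    generalize (a : ℝ) + 1 = r at *
    generalize (b : ℝ) + 1 = s at *
    have hp : 1 ≤ r * α := one_le_mul_of_one_le_of_one_le ha hα
    have ht : 1 ≤ s * β := one_le_mul_of_one_le_of_one_le hb hβ
    generalize r * α = p at *
    generalize s * β = t at *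
    simp only [nrm2, Matrix.cons_val_zero, Matrix.cons_val_one]
    rw [← Real.sqrt_mul (by linarith)]
    refine Real.sqrt_le_sqrt ?_
    obtain ⟨u, hu⟩ : ∃ u, u = S - (1 + p ^ 2) := ⟨_, rfl⟩
    obtain ⟨v, hv⟩ : ∃ v, v = S - (t ^ 2 + (1 + p * t) ^ 2) := ⟨_, rfl⟩
    have huv : u * v = (t + p * (1 + p * t)) ^ 2 := by rw [hu, hv]; linear_combination h1
    have huv1 : 0 ≤ u + v := by rw [hu, hv]; nlinarith
    have huv0 : 0 ≤ u * v := by rw [huv]; positivity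
    have hu0 : 0 ≤ u := by
      by_contra hneg
      push Not at hneg
      nlinarith
    have hv0 : 0 ≤ v := by
      by_contra hneg
      push Not at hneg
      nlinarith
    have key : 2 * ((t + p * (1 + p * t)) * (x * y)) ≤ u * x ^ 2 + v * y ^ 2 := by
      refine abs_le_of_sq_le_sq ?_ (by positivity) |> fun h => (le_abs_self _).trans h
      have : 0 ≤ (u * x ^ 2 - v * y ^ 2) ^ 2 := sq_nonneg _
      have e : (2 * ((t + p * (1 + p * t)) * (x * y))) ^ 2 = 4 * (u * v) * (x * y) ^ 2 := by
        rw [huv]; ring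
      rw [e]
      nlinarith
    rw [hu, hv] at key
    nlinarith

theorem global_cone_bounds (α β lam : ℝ) (hα : 1 ≤ α) (hβ : 1 ≤ β)
    (hlam : Tendsto (fun N : ℕ =>
        ((N : ℝ))⁻¹ * ((2 : ℝ) ^ N)⁻¹ *
          ∑ i : Fin N → Fin 2,
            Real.log (nrm2 ((wordProd !![1, 0; α, 1] !![1, β; 0, 1] N i).mulVec ![0, 1])))
      atTop (nhds lam)) :
    max (max (coneSum (phi1 α β)) (coneSum (phi2 α β))) (coneSum (phiInf α β)) ≤ 4 * lam ∧
      4 * lam ≤ min (min (coneSum (psi1 α β)) (coneSum (psi2 α β))) (coneSum (psiInf α β)) := by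
  have hlam' : Tendsto (fun N : ℕ => ((N : ℝ))⁻¹ *
      EE α β (fun x y => Real.log (nrm2 ![x, y])) N 0 1) atTop (nhds lam) := by
    refine hlam.congr (fun N => ?_)
    rw [mul_assoc, bridge]
  refine ⟨max_le (max_le ?_ ?_) ?_, le_min (le_min ?_ ?_) ?_⟩
  · exact lower_phi1 α β hα hβ lam hlam'
  · exact lower_phi2 α β hα hβ lam hlam'
  · exact lower_phiInf α β hα hβ lam hlam'
  · exact upper_psi1 α β hα hβ lam hlam'
  · exact upper_psi2 α β hα hβ lam hlam'
  · exact upper_psiInf α β hα hβ lam hlam'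

end
end

section
/- Let λ be the Lyapunov exponent of the i.i.d. random product of A and B in the case α < −2, β > 2. Then max{L̃₁, L̃₂, L̃_∞} ≤ 4λ ≤ min{Ũ₁, Ũ₂, Ũ_∞}, where for k ∈ {1,2,∞}, L̃_k = Σ_{a,b=1}^∞ 2^{−a−b} log φ̃_k(a,b) and Ũ_k = Σ_{a,b=1}^∞ 2^{−a−b} log ψ̃_k(a,b). -/
open Filter

noncomputable section

def Gam (α β : ℝ) : ℝ := -(β / 2) + Real.sqrt ((β / 2) ^ 2 + β / α)

def phit1 (α β : ℝ) (a b : ℕ) : ℝ :=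
  (b * β + Gam α β - a * α * (b * β) - 1 - a * α * Gam α β) / (1 - Gam α β)

def phit2 (α β : ℝ) (a b : ℕ) : ℝ :=
  Real.sqrt (((Gam α β + b * β) ^ 2 + (1 + a * α * Gam α β + a * α * (b * β)) ^ 2) /
    (1 + Gam α β ^ 2))

def phitInf (α β : ℝ) (a b : ℕ) : ℝ := -(a * α * (b * β)) - a * α * Gam α β - 1

def psit1 (α β : ℝ) (a b : ℕ) : ℝ := b * β - a * α * (b * β) - 1

def psit2 (α β : ℝ) (a b : ℕ) : ℝ :=
  Real.sqrt ((1 + a * α * (b * β)) ^ 2 + (b : ℝ) ^ 2 * β ^ 2)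

def psitInf (α β : ℝ) (a b : ℕ) : ℝ := -(a * α * (b * β)) - 1

/-! ### Averages over words -/

def gE : ℕ → (List (Fin 2) → ℝ) → ℝ
  | 0, f => f []
  | n + 1, f => gE n (fun l => (f (0 :: l) + f (1 :: l)) / 2)

lemma gE_mono (n : ℕ) : ∀ f g : List (Fin 2) → ℝ, (∀ l, f l ≤ g l) → gE n f ≤ gE n g := by
  induction n with
  | zero => intro f g h; exact h _
  | succ n ih =>
    intro f g h
    apply ih
    intro l
    have h0 := h (0 :: l)
    have h1 := h (1 :: l)
    linarith

lemma gE_add (n : ℕ) : ∀ f g : List (Fin 2) → ℝ,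
    gE n (fun l => f l + g l) = gE n f + gE n g := by
  induction n with
  | zero => intro f g; rfl
  | succ n ih =>
    intro f g
    simp only [gE]
    rw [← ih]
    congr 1
    funext l
    ring

lemma gE_mul (n : ℕ) (k : ℝ) : ∀ f : List (Fin 2) → ℝ,
    gE n (fun l => k * f l) = k * gE n f := by
  induction n with
  | zero => intro f; rfl
  | succ n ih =>
    intro f
    simp only [gE]
    rw [← ih]
    congr 1
    funext l
    ring

lemma gE_const (n : ℕ) (k : ℝ) : gE n (fun _ => k) = k := by
  induction n with
  | zero => rfl
  | succ n ih =>
    simp only [gE]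
    have : (k + k) / 2 = k := by ring
    rw [this, ih]

lemma gE_eq (n : ℕ) : ∀ f : List (Fin 2) → ℝ,
    ((2 : ℝ) ^ n)⁻¹ * ∑ i : Fin n → Fin 2, f ((List.ofFn i).reverse) = gE n f := by
  induction n with
  | zero => intro f; simp [gE]
  | succ n ih =>
    intro f
    simp only [gE]
    rw [← ih]
    have key : ∑ i : Fin (n + 1) → Fin 2, f ((List.ofFn i).reverse)
        = ∑ p : Fin 2 × (Fin n → Fin 2), f (p.1 :: (List.ofFn p.2).reverse) := by
      symm
      apply Fintype.sum_equiv (Fin.snocEquiv (fun _ : Fin (n + 1) => Fin 2))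
      intro p
      rw [List.ofFn_succ']
      simp [Fin.snocEquiv]
    rw [key, Fintype.sum_prod_type, Fin.sum_univ_two, ← Finset.sum_add_distrib,
      ← Finset.sum_div, pow_succ]
    field_simp

/-! ### The state machine -/

def gst : List (Fin 2) → ℕ × ℕ
  | [] => (0, 0)
  | c :: l => if c = 0 then (if (gst l).1 = 0 then (0, 0) else ((gst l).1, (gst l).2 + 1))
      else (if (gst l).2 = 0 then ((gst l).1 + 1, 0) else (1, 0))

def gS (T : ℕ → ℕ → ℝ) : List (Fin 2) → ℝ
  | [] => 0
  | c :: l => if c = 0 then gS T l else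
      (if (gst l).2 = 0 then gS T l else gS T l + T (gst l).2 (gst l).1)

lemma gst_zero (l : List (Fin 2)) : (gst l).1 = 0 → (gst l).2 = 0 := by
  cases l with
  | nil => simp [gst]
  | cons c l =>
    simp only [gst]
    split_ifs <;> simp_all

def gV (p : ℕ × ℕ) : ℝ := if p.2 = 0 then 2 * (p.1 : ℝ) else p.1 + p.2

lemma gV_ge (p : ℕ × ℕ) : (p.1 : ℝ) + p.2 ≤ gV p := by
  unfold gV
  have : (0 : ℝ) ≤ p.1 := Nat.cast_nonneg _
  split_ifs with h
  · rw [h]; push_cast; linarith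
  · exact le_rfl

lemma gV_step (l : List (Fin 2)) :
    (gV (gst (0 :: l)) + gV (gst (1 :: l))) / 2 ≤ 3 / 4 * gV (gst l) + 3 / 2 := by
  have h0 := gst_zero l
  simp only [gst]
  rcases hp : gst l with ⟨b, a⟩
  rw [hp] at h0
  simp only at h0 ⊢
  have hb0 : (0 : ℝ) ≤ b := Nat.cast_nonneg _
  have ha0 : (0 : ℝ) ≤ a := Nat.cast_nonneg _
  by_cases hb : b = 0
  · have ha := h0 hb
    subst hb; subst ha
    simp [gV]
    norm_num
  · by_cases ha : a = 0
    · subst ha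
      simp [gV, hb]
      linarith
    · simp [gV, hb, ha]
      linarith

lemma gE_V (n : ℕ) : gE n (fun l => gV (gst l)) ≤ 6 := by
  induction n with
  | zero => simp [gE, gst, gV]
  | succ n ih =>
    simp only [gE]
    calc _ ≤ gE n (fun l => 3 / 4 * gV (gst l) + 3 / 2) := gE_mono _ _ _ (gV_step)
      _ = 3 / 4 * gE n (fun l => gV (gst l)) + 3 / 2 := by
        rw [gE_add n (fun l => 3 / 4 * gV (gst l)) (fun _ => 3 / 2), gE_const, gE_mul]
      _ ≤ 6 := by linarith

/-! ### Geometric averages -/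

def gW (f : ℕ → ℝ) (n : ℕ) : ℝ := ∑' j : ℕ, (1 / 2 : ℝ) ^ (j + 1) * f (n + j)

lemma hasSum_of_eq {f g : ℕ → ℝ} {x y : ℝ} (h : HasSum g x) (h1 : ∀ j, f j = g j)
    (h2 : y = x) : HasSum f y := by
  rw [h2, funext h1]
  exact h

lemma geo_one : HasSum (fun j : ℕ => (1 / 2 : ℝ) ^ (j + 1)) 1 := by
  have h := (hasSum_geometric_two).mul_left (1 / 2 : ℝ)
  refine hasSum_of_eq h (fun j => ?_) ?_
  · ring
  · norm_num

lemma geo_lin : HasSum (fun j : ℕ => (1 / 2 : ℝ) ^ (j + 1) * j) 1 := by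
  have h := (hasSum_coe_mul_geometric_of_norm_lt_one (𝕜 := ℝ) (r := 1 / 2)
    (by norm_num)).mul_left (1 / 2 : ℝ)
  refine hasSum_of_eq h (fun j => ?_) ?_
  · ring
  · norm_num

lemma geo_dom (C D : ℝ) : HasSum (fun j : ℕ => (1 / 2 : ℝ) ^ (j + 1) * (C * (D + j)))
    (C * (D + 1)) := by
  have h := (geo_one.mul_left (C * D)).add (geo_lin.mul_left C)
  refine hasSum_of_eq h (fun j => ?_) ?_
  · ring
  · ring

lemma gW_bd {f : ℕ → ℝ} {n : ℕ} {C D : ℝ} (h : ∀ j : ℕ, |f (n + j)| ≤ C * (D + j)) :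
    Summable (fun j : ℕ => (1 / 2 : ℝ) ^ (j + 1) * f (n + j)) ∧ |gW f n| ≤ C * (D + 1) := by
  have hb : ∀ j : ℕ, ‖(1 / 2 : ℝ) ^ (j + 1) * f (n + j)‖ ≤
      (1 / 2 : ℝ) ^ (j + 1) * (C * (D + j)) := by
    intro j
    rw [norm_mul, Real.norm_eq_abs, Real.norm_eq_abs, abs_of_pos (by positivity)]
    exact mul_le_mul_of_nonneg_left (h j) (by positivity)
  refine ⟨Summable.of_norm_bounded (geo_dom C D).summable hb, ?_⟩
  exact tsum_of_norm_bounded (geo_dom C D) hb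

lemma gW_rec {f : ℕ → ℝ} {n : ℕ} {C D : ℝ} (h : ∀ j : ℕ, |f (n + j)| ≤ C * (D + j)) :
    gW f n = 1 / 2 * f n + 1 / 2 * gW f (n + 1) := by
  unfold gW
  rw [(gW_bd h).1.tsum_eq_zero_add, ← tsum_mul_left]
  congr 1
  · simp
  · congr 1
    funext j
    rw [show n + 1 + j = n + (j + 1) by ring]
    ring

/-! ### The potential -/

def gG1 (T : ℕ → ℕ → ℝ) (b a : ℕ) : ℝ := gW (fun a => T a b) a
def gG0 (T : ℕ → ℕ → ℝ) (b : ℕ) : ℝ := gW (fun b => gG1 T b 1) b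

def gG (T : ℕ → ℕ → ℝ) (c : ℝ) (p : ℕ × ℕ) : ℝ :=
  if p.2 = 0 then (if p.1 = 0 then -(2 * c) else gG0 T p.1 - 4 * c) else gG1 T p.1 p.2 - 2 * c

lemma G1_aux {T : ℕ → ℕ → ℝ} {C : ℝ}
    (hT : ∀ a b : ℕ, 1 ≤ a → 1 ≤ b → |T a b| ≤ C * (a + b))
    {a b : ℕ} (ha : 1 ≤ a) (hb : 1 ≤ b) :
    ∀ j : ℕ, |(fun a => T a b) (a + j)| ≤ C * ((a + b : ℝ) + j) := by
  intro j
  have := hT (a + j) b (by omega) hb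
  push_cast at this
  calc _ ≤ _ := this
    _ = _ := by ring

lemma G1_bd {T : ℕ → ℕ → ℝ} {C : ℝ}
    (hT : ∀ a b : ℕ, 1 ≤ a → 1 ≤ b → |T a b| ≤ C * (a + b))
    {a b : ℕ} (ha : 1 ≤ a) (hb : 1 ≤ b) : |gG1 T b a| ≤ C * (a + b + 1) :=
  (gW_bd (G1_aux hT ha hb)).2

lemma G0_aux {T : ℕ → ℕ → ℝ} {C : ℝ}
    (hT : ∀ a b : ℕ, 1 ≤ a → 1 ≤ b → |T a b| ≤ C * (a + b))
    {b : ℕ} (hb : 1 ≤ b) :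
    ∀ j : ℕ, |(fun b => gG1 T b 1) (b + j)| ≤ C * ((b + 2 : ℝ) + j) := by
  intro j
  have := G1_bd hT (a := 1) (b := b + j) le_rfl (by omega)
  push_cast at this
  calc _ ≤ _ := this
    _ = _ := by ring

lemma G0_bd {T : ℕ → ℕ → ℝ} {C : ℝ}
    (hT : ∀ a b : ℕ, 1 ≤ a → 1 ≤ b → |T a b| ≤ C * (a + b))
    {b : ℕ} (hb : 1 ≤ b) : |gG0 T b| ≤ C * (b + 2 + 1) :=
  (gW_bd (G0_aux hT hb)).2

lemma G_step {T : ℕ → ℕ → ℝ} {C : ℝ}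
    (hT : ∀ a b : ℕ, 1 ≤ a → 1 ≤ b → |T a b| ≤ C * (a + b))
    {c : ℝ} (hc : gG0 T 1 = 4 * c) (l : List (Fin 2)) :
    ((gS T (0 :: l) + gG T c (gst (0 :: l))) + (gS T (1 :: l) + gG T c (gst (1 :: l)))) / 2
      = gS T l + gG T c (gst l) + c := by
  have h0 := gst_zero l
  simp only [gst, gS]
  rcases hp : gst l with ⟨b, a⟩
  rw [hp] at h0
  simp only at h0 ⊢
  by_cases hb : b = 0
  · have ha := h0 hb
    subst hb; subst ha
    simp [gG, hc]
    ring
  · by_cases ha : a = 0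
    · subst ha
      have := gW_rec (f := fun b => gG1 T b 1) (n := b) (G0_aux hT (b := b) (by omega))
      change gG0 T b = 1 / 2 * gG1 T b 1 + 1 / 2 * gG0 T (b + 1) at this
      simp [gG, hb]
      linarith
    · have := gW_rec (f := fun a => T a b) (n := a) (G1_aux hT (a := a) (b := b) (by omega) (by omega))
      change gG1 T b a = 1 / 2 * T a b + 1 / 2 * gG1 T b (a + 1) at this
      simp [gG, hb, ha, hc]
      linarith

lemma G_abs {T : ℕ → ℕ → ℝ} {C : ℝ}
    (hT : ∀ a b : ℕ, 1 ≤ a → 1 ≤ b → |T a b| ≤ C * (a + b))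
    {c : ℝ} (l : List (Fin 2)) (hC : 0 ≤ C) :
    |gG T c (gst l)| ≤ C * gV (gst l) + (3 * C + 4 * |c|) := by
  have h0 := gst_zero l
  have hv := mul_le_mul_of_nonneg_left (gV_ge (gst l)) hC
  rcases hp : gst l with ⟨b, a⟩
  rw [hp] at h0 hv
  simp only at h0 hv
  have hb0 : (0 : ℝ) ≤ b := Nat.cast_nonneg _
  have ha0 : (0 : ℝ) ≤ a := Nat.cast_nonneg _
  have hca := abs_nonneg c
  have := mul_nonneg hC hb0
  have := mul_nonneg hC ha0
  have hc1 := abs_le.1 (le_refl |c|)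
  unfold gG
  simp only
  split_ifs with ha hb
  · rw [abs_le]
    constructor <;> linarith [hc1.1, hc1.2]
  · have := abs_le.1 (G0_bd hT (b := b) (by omega))
    rw [abs_le]
    constructor <;> linarith [hc1.1, hc1.2, this.1, this.2]
  · have := abs_le.1 (G1_bd hT (a := a) (b := b) (by omega) (by
      rcases Nat.eq_zero_or_pos b with h | h
      · exact absurd (h0 h) ha
      · exact h))
    rw [abs_le]
    constructor <;> linarith [hc1.1, hc1.2, this.1, this.2]

lemma E_P {T : ℕ → ℕ → ℝ} {C : ℝ}
    (hT : ∀ a b : ℕ, 1 ≤ a → 1 ≤ b → |T a b| ≤ C * (a + b))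
    {c : ℝ} (hc : gG0 T 1 = 4 * c) (n : ℕ) :
    gE n (fun l => gS T l + gG T c (gst l)) = n * c - 2 * c := by
  induction n with
  | zero => simp [gE, gS, gst, gG]
  | succ n ih =>
    simp only [gE]
    rw [show (fun l => ((gS T (0 :: l) + gG T c (gst (0 :: l))) +
      (gS T (1 :: l) + gG T c (gst (1 :: l)))) / 2) =
      (fun l => (gS T l + gG T c (gst l)) + (fun _ => c) l) from funext (G_step hT hc)]
    rw [gE_add, gE_const, ih]
    push_cast
    ring

lemma E_S {T : ℕ → ℕ → ℝ} {C : ℝ}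
    (hT : ∀ a b : ℕ, 1 ≤ a → 1 ≤ b → |T a b| ≤ C * (a + b))
    {c : ℝ} (hc : gG0 T 1 = 4 * c) (hC : 0 ≤ C) :
    ∃ K : ℝ, ∀ n : ℕ, |gE n (gS T) - n * c| ≤ K := by
  refine ⟨9 * C + 6 * |c|, fun n => ?_⟩
  have h1 := E_P hT hc n
  rw [gE_add] at h1
  have hV : gE n (fun l => C * gV (gst l) + (3 * C + 4 * |c|)) ≤ 9 * C + 4 * |c| := by
    rw [gE_add n (fun l => C * gV (gst l)) (fun _ => (3 * C + 4 * |c|)), gE_const, gE_mul]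
    have := mul_le_mul_of_nonneg_left (gE_V n) hC
    linarith
  have hu := gE_mono n (fun l => gG T c (gst l)) (fun l => C * gV (gst l) + (3 * C + 4 * |c|))
    (fun l => (abs_le.1 (G_abs hT l hC)).2)
  have hl := gE_mono n (fun l => (-1) * (C * gV (gst l) + (3 * C + 4 * |c|)))
    (fun l => gG T c (gst l)) (fun l => by linarith [(abs_le.1 (G_abs hT (c := c) l hC)).1])
  rw [gE_mul] at hl
  have hc1 := abs_le.1 (le_refl |c|)
  rw [abs_le]
  constructor <;> linarith [hc1.1, hc1.2]

lemma coneSum_eq_s6 {T : ℕ → ℕ → ℝ} {C : ℝ}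
    (hT : ∀ a b : ℕ, 1 ≤ a → 1 ≤ b → |T a b| ≤ C * (a + b))
    {f : ℕ → ℕ → ℝ} (hf : ∀ a b : ℕ, 1 ≤ a → 1 ≤ b → Real.log (f a b) = T a b)
    (hC : 0 ≤ C) : gG0 T 1 = coneSum f := by
  have e1 : coneSum f = ∑' (a : ℕ) (b : ℕ),
      (1 / 2 : ℝ) ^ (a + 1) * ((1 / 2 : ℝ) ^ (b + 1) * T (a + 1) (b + 1)) := by
    unfold coneSum
    congr 1; funext a; congr 1; funext b
    rw [hf _ _ (by omega) (by omega)]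
    rw [← mul_assoc, ← pow_add, one_div, inv_pow]
    congr 3
    ring
  have hs : Summable (Function.uncurry fun (a b : ℕ) =>
      (1 / 2 : ℝ) ^ (a + 1) * ((1 / 2 : ℝ) ^ (b + 1) * T (a + 1) (b + 1))) := by
    have h1 : Summable (fun j : ℕ => (1 / 2 : ℝ) ^ (j + 1) * (1 * (2 + j))) :=
      (geo_dom 1 2).summable
    have h2 := (h1.mul_of_nonneg h1 (fun j => by positivity) (fun j => by positivity)).mul_left C
    refine Summable.of_norm_bounded h2 ?_
    rintro ⟨a, b⟩
    have := hT (a + 1) (b + 1) (by omega) (by omega)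
    push_cast at this
    simp only [Function.uncurry]
    rw [norm_mul, norm_mul, Real.norm_eq_abs, Real.norm_eq_abs, Real.norm_eq_abs,
      abs_of_pos (by positivity), abs_of_pos (a := (1 / 2 : ℝ) ^ (b + 1)) (by positivity)]
    have hab : C * ((a : ℝ) + 1 + (b + 1)) ≤ C * ((2 + a) * (2 + b)) := by
      apply mul_le_mul_of_nonneg_left _ hC
      have : (0 : ℝ) ≤ a := Nat.cast_nonneg _
      have : (0 : ℝ) ≤ b := Nat.cast_nonneg _
      nlinarith
    calc _ ≤ (1 / 2 : ℝ) ^ (a + 1) * ((1 / 2 : ℝ) ^ (b + 1) * (C * ((2 + a) * (2 + b)))) := by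
          have := this.trans hab
          gcongr
      _ = _ := by ring
  rw [e1, ← hs.tsum_comm]
  unfold gG0 gG1 gW
  congr 1; funext b
  rw [← tsum_mul_left]
  congr 1; funext a
  rw [add_comm 1 a, add_comm 1 b]
  ring



/-! ### Geometry of the cone -/

def gX (α β : ℝ) : List (Fin 2) → ℝ × ℝ
  | [] => (0, 1)
  | c :: l => if c = 0 then ((gX α β l).1, α * (gX α β l).1 + (gX α β l).2)
      else ((gX α β l).1 + β * (gX α β l).2, (gX α β l).2)

lemma gX_eq (α β : ℝ) (l : List (Fin 2)) :
    ((l.map fun k => if k = 0 then !![1, 0; α, 1] else !![1, β; 0, 1]).prod).mulVec ![0, 1]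
      = ![(gX α β l).1, (gX α β l).2] := by
  induction l with
  | nil => simp [gX]
  | cons c l ih =>
    rw [List.map_cons, List.prod_cons, ← Matrix.mulVec_mulVec, ih]
    simp only [gX]
    split_ifs
    · funext i; fin_cases i <;> simp [Matrix.mulVec, dotProduct, Fin.sum_univ_two]
    · funext i; fin_cases i <;> simp [Matrix.mulVec, dotProduct, Fin.sum_univ_two]

lemma word_eq (α β : ℝ) (N : ℕ) (i : Fin N → Fin 2) :
    (wordProd !![1, 0; α, 1] !![1, β; 0, 1] N i).mulVec ![0, 1]
      = ![(gX α β (List.ofFn i).reverse).1, (gX α β (List.ofFn i).reverse).2] := by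
  rw [← gX_eq]
  unfold wordProd
  rw [List.map_reverse, List.map_ofFn]
  rfl

lemma gam_facts {α β : ℝ} (hα : α < -2) (hβ : 2 < β) :
    -1 < Gam α β ∧ Gam α β < 0 ∧ α * Gam α β * (Gam α β + β) = β := by
  have h1 : β / α < 0 := div_neg_of_pos_of_neg (by linarith) (by linarith)
  have h2 : -(β / 2) < β / α := by
    rw [lt_div_iff_of_neg (by linarith)]
    nlinarith
  have hD : (β / 2 - 1) ^ 2 < (β / 2) ^ 2 + β / α := by nlinarith
  have hD0 : 0 ≤ (β / 2) ^ 2 + β / α := by nlinarith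
  have hs := Real.sq_sqrt hD0
  have hl : β / 2 - 1 < Real.sqrt ((β / 2) ^ 2 + β / α) := Real.lt_sqrt_of_sq_lt hD
  have hu : Real.sqrt ((β / 2) ^ 2 + β / α) < β / 2 := by
    rw [Real.sqrt_lt' (by linarith)]
    linarith
  refine ⟨by unfold Gam; linarith, by unfold Gam; linarith, ?_⟩
  have : Gam α β * (Gam α β + β) = β / α := by
    unfold Gam
    nlinarith
  rw [mul_assoc, this]
  have hα0 : α ≠ 0 := by intro h; linarith
  field_simp

/-- coordinates of `A^a B^b (z, 1)` -/
def gx (β : ℝ) (b : ℕ) (z : ℝ) : ℝ := z + b * β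
def gy (α β : ℝ) (a b : ℕ) (z : ℝ) : ℝ := 1 + a * α * gx β b z

/-- logarithmic growth -/
def gg (α β : ℝ) (m : ℝ → ℝ) (a b : ℕ) (z : ℝ) : ℝ :=
  Real.log (-gy α β a b z) + m (gx β b z / gy α β a b z) - m z

lemma gx_ge {α β : ℝ} (hα : α < -2) (hβ : 2 < β)
    {b : ℕ} (hb : 1 ≤ b) {z : ℝ} (hz : Gam α β ≤ z) : Gam α β + β ≤ gx β b z := by
  unfold gx
  have : (1 : ℝ) ≤ b := by exact_mod_cast hb
  nlinarith

lemma gx_gt {α β : ℝ} (hα : α < -2) (hβ : 2 < β)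
    {b : ℕ} (hb : 1 ≤ b) {z : ℝ} (hz : Gam α β ≤ z) : 1 < gx β b z := by
  have := gx_ge hα hβ hb hz
  have := (gam_facts hα hβ).1
  linarith

lemma gy_lt {α β : ℝ} (hα : α < -2) (hβ : 2 < β)
    {a b : ℕ} (ha : 1 ≤ a) (hb : 1 ≤ b) {z : ℝ} (hz : Gam α β ≤ z) :
    1 < -gy α β a b z := by
  have h1 := gx_gt hα hβ hb hz
  have h2 : (1 : ℝ) ≤ a := by exact_mod_cast ha
  unfold gy
  have h3 : 2 < a * (-α) := by nlinarith
  nlinarith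

lemma z_ge {α β : ℝ} (hα : α < -2) (hβ : 2 < β)
    {a b : ℕ} (ha : 1 ≤ a) (hb : 1 ≤ b) {z : ℝ} (hz : Gam α β ≤ z) :
    Gam α β ≤ gx β b z / gy α β a b z := by
  have h1 := gx_ge hα hβ hb hz
  have h1' := gx_gt hα hβ hb hz
  have h2 : (1 : ℝ) ≤ a := by exact_mod_cast ha
  have hy := gy_lt hα hβ ha hb hz
  obtain ⟨g1, g2, g3⟩ := gam_facts hα hβ
  rw [le_div_iff_of_neg (by linarith)]
  unfold gy
  set G := Gam α β
  set x := gx β b z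
  have hp : 0 < α * G := mul_pos_of_neg_of_neg (by linarith) g2
  have h4 : α * G * x ≤ a * (α * G * x) := by
    have : 0 < α * G * x := by positivity
    nlinarith
  have h5 : (α * G - 1) * (G + β) = -G := by linarith
  have h6 : 0 ≤ α * G - 1 := by
    by_contra h
    nlinarith
  have h7 : (α * G - 1) * (G + β) ≤ (α * G - 1) * x := mul_le_mul_of_nonneg_left h1 h6
  linarith

lemma z_le {α β : ℝ} (hα : α < -2) (hβ : 2 < β)
    {a b : ℕ} (ha : 1 ≤ a) (hb : 1 ≤ b) {z : ℝ} (hz : Gam α β ≤ z) :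
    gx β b z / gy α β a b z ≤ 0 := by
  have h1' := gx_gt hα hβ hb hz
  have hy := gy_lt hα hβ ha hb hz
  exact div_nonpos_of_nonneg_of_nonpos (by linarith) (by linarith)

lemma inv_all {α β : ℝ} (hα : α < -2) (hβ : 2 < β)
    {m : ℝ → ℝ} {T : ℕ → ℕ → ℝ} {s : ℝ} (hm0 : m 0 = 0)
    (hs : ∀ a b : ℕ, 1 ≤ a → 1 ≤ b → ∀ z, Gam α β ≤ z → z ≤ 0 →
      0 ≤ s * (gg α β m a b z - T a b)) (l : List (Fin 2)) :
    ∃ q z : ℝ, q ≠ 0 ∧ Gam α β ≤ z ∧ z ≤ 0 ∧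
      gX α β l = (q * gx β (gst l).1 z, q * gy α β (gst l).2 (gst l).1 z) ∧
      ((gst l).1 = 0 → z = 0) ∧
      0 ≤ s * (Real.log |q| + m z - gS T l) := by
  have hG := gam_facts hα hβ
  induction l with
  | nil => exact ⟨1, 0, one_ne_zero, hG.2.1.le, le_rfl, by simp [gX, gst, gx, gy],
      fun _ => rfl, by simp [gS, hm0]⟩
  | cons c l ih =>
    obtain ⟨q, z, hq, hz1, hz2, hX, hz0, hS⟩ := ih
    have h0 := gst_zero l
    simp only [gX, gst, gS]
    rw [hX]
    rcases hp : gst l with ⟨b, a⟩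
    rw [hp] at h0 hz0
    simp only at h0 hz0 ⊢
    by_cases hc : c = 0
    · simp only [hc, if_true]
      refine ⟨q, z, hq, hz1, hz2, ?_, ?_, hS⟩
      · by_cases hb : b = 0
        · have ha := h0 hb
          have hz := hz0 hb
          subst hb; subst ha; subst hz
          simp [gx, gy]
        · simp only [hb, if_false]
          refine Prod.ext rfl ?_
          simp only [gx, gy]
          push_cast
          ring
      · by_cases hb : b = 0
        · exact fun _ => hz0 hb
        · simp [hb]
    · simp only [hc, if_false]
      by_cases ha : a = 0
      · simp only [ha, if_true]
        refine ⟨q, z, hq, hz1, hz2, ?_, by simp, hS⟩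
        refine Prod.ext ?_ ?_
        · simp only [gx, gy]
          push_cast
          ring
        · simp only [gx, gy]
          push_cast
          ring
      · have ha1 : 1 ≤ a := by omega
        have hb1 : 1 ≤ b := by
          rcases Nat.eq_zero_or_pos b with h | h
          · exact absurd (h0 h) ha
          · exact h
        simp only [ha, if_false]
        have hy := gy_lt hα hβ ha1 hb1 hz1
        have hy0 : gy α β a b z ≠ 0 := by intro h; rw [h] at hy; linarith
        refine ⟨q * gy α β a b z, gx β b z / gy α β a b z, mul_ne_zero hq hy0,
          z_ge hα hβ ha1 hb1 hz1, z_le hα hβ ha1 hb1 hz1, ?_, by simp, ?_⟩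
        · generalize gx β b z = x
          generalize gy α β a b z = y at *
          refine Prod.ext ?_ ?_
          · simp only [gx]
            push_cast
            field_simp
          · simp [gy]
        · have h1 := hs a b ha1 hb1 z hz1 hz2
          have h2 : Real.log |q * gy α β a b z| = Real.log |q| + Real.log (-gy α β a b z) := by
            rw [abs_mul, Real.log_mul (abs_ne_zero.2 hq) (abs_ne_zero.2 hy0),
              abs_of_neg (a := gy α β a b z) (by linarith)]
          rw [h2]
          unfold gg at h1
          linarith

lemma nrm_ge {α β : ℝ} (hα : α < -2) (hβ : 2 < β)
    {a b : ℕ} {q z : ℝ} (hq : q ≠ 0) (hz : Gam α β ≤ z) (h0 : b = 0 → a = 0) :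
    Real.log |q| ≤ Real.log (nrm2 ![q * gx β b z, q * gy α β a b z]) := by
  apply Real.log_le_log (abs_pos.2 hq)
  unfold nrm2
  apply Real.le_sqrt_of_sq_le
  simp only [Matrix.cons_val_zero, Matrix.cons_val_one]
  rw [sq_abs]
  have hy : 1 ≤ gy α β a b z ^ 2 := by
    by_cases ha : a = 0
    · simp [gy, ha]
    · have := gy_lt hα hβ (a := a) (b := b) (by omega) (by omega) hz
      nlinarith
  nlinarith [sq_nonneg (q * gx β b z), sq_nonneg q]

lemma growth_le {α β : ℝ} (hα : α < -2) (hβ : 2 < β)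
    {a b : ℕ} {z : ℝ} (hz : Gam α β ≤ z) (hz0 : z ≤ 0) :
    |gx β b z| + |gy α β a b z| ≤ (2 + b * β) * (1 + a * (-α)) := by
  have hG := (gam_facts hα hβ).1
  have hb : (0 : ℝ) ≤ b := Nat.cast_nonneg _
  have ha : (0 : ℝ) ≤ a := Nat.cast_nonneg _
  have hbb : 0 ≤ b * β := mul_nonneg hb (by linarith)
  have haa : 0 ≤ a * (-α) := mul_nonneg ha (by linarith)
  have hx : |gx β b z| ≤ 1 + b * β := by
    unfold gx
    rw [abs_le]
    constructor <;> linarith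
  have hy : |gy α β a b z| ≤ 1 + a * (-α) * |gx β b z| := by
    unfold gy
    calc _ ≤ |(1 : ℝ)| + |a * α * gx β b z| := abs_add_le _ _
      _ = _ := by
        rw [abs_one, abs_mul, abs_mul, abs_of_nonneg ha, abs_of_neg (a := α) (by linarith)]
  have := mul_le_mul_of_nonneg_left hx haa
  nlinarith

lemma log_growth {α β : ℝ} (hα : α < -2) (hβ : 2 < β)
    {a b : ℕ} :
    Real.log ((2 + b * β) * (1 + a * (-α))) ≤ 1 + b * β + a * (-α) := by
  have hb : (0 : ℝ) ≤ b := Nat.cast_nonneg _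
  have ha : (0 : ℝ) ≤ a := Nat.cast_nonneg _
  have hbb : 0 ≤ b * β := mul_nonneg hb (by linarith)
  have haa : 0 ≤ a * (-α) := mul_nonneg ha (by linarith)
  rw [Real.log_mul (by linarith) (by linarith)]
  have h1 := Real.log_le_sub_one_of_pos (x := 2 + b * β) (by linarith)
  have h2 := Real.log_le_sub_one_of_pos (x := 1 + a * (-α)) (by linarith)
  linarith

lemma nrm_le {α β : ℝ} (hα : α < -2) (hβ : 2 < β)
    {a b : ℕ} {q z : ℝ} (hq : q ≠ 0) (hz : Gam α β ≤ z) (hz0 : z ≤ 0)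
    (h0 : b = 0 → a = 0) :
    Real.log (nrm2 ![q * gx β b z, q * gy α β a b z]) ≤
      Real.log |q| + (1 + b * β + a * (-α)) := by
  have hb : (0 : ℝ) ≤ b := Nat.cast_nonneg _
  have ha : (0 : ℝ) ≤ a := Nat.cast_nonneg _
  have hbb : 0 ≤ b * β := mul_nonneg hb (by linarith)
  have haa : 0 ≤ a * (-α) := mul_nonneg ha (by linarith)
  have hqp := abs_pos.2 hq
  have hgr := growth_le hα hβ (a := a) (b := b) hz hz0
  have hle : nrm2 ![q * gx β b z, q * gy α β a b z] ≤
      |q| * ((2 + b * β) * (1 + a * (-α))) := by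
    refine le_trans ?_ (mul_le_mul_of_nonneg_left hgr hqp.le)
    unfold nrm2
    simp only [Matrix.cons_val_zero, Matrix.cons_val_one]
    apply Real.sqrt_le_iff.2
    refine ⟨by positivity, ?_⟩
    have e : (|q| * (|gx β b z| + |gy α β a b z|)) ^ 2 =
      q ^ 2 * (gx β b z ^ 2 + gy α β a b z ^ 2 + 2 * (|gx β b z| * |gy α β a b z|)) := by
      rw [mul_pow, sq_abs, add_sq, sq_abs, sq_abs]; ring
    rw [e]
    have : 0 ≤ q ^ 2 * (2 * (|gx β b z| * |gy α β a b z|)) := by positivity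
    nlinarith
  have hpos : 0 < nrm2 ![q * gx β b z, q * gy α β a b z] := by
    unfold nrm2
    simp only [Matrix.cons_val_zero, Matrix.cons_val_one]
    apply Real.sqrt_pos.2
    have hy : gy α β a b z ≠ 0 := by
      by_cases ha : a = 0
      · simp [gy, ha]
      · have := gy_lt hα hβ (a := a) (b := b) (by omega) (by omega) hz
        intro h; rw [h] at this; linarith
    have : 0 < (q * gy α β a b z) ^ 2 := by positivity
    have := sq_nonneg (q * gx β b z)
    linarith
  calc _ ≤ Real.log (|q| * ((2 + b * β) * (1 + a * (-α)))) := Real.log_le_log hpos hle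
    _ = Real.log |q| + Real.log ((2 + b * β) * (1 + a * (-α))) :=
      Real.log_mul hqp.ne' (by positivity)
    _ ≤ _ := by linarith [log_growth hα hβ (a := a) (b := b)]

lemma gg_bd {α β : ℝ} (hα : α < -2) (hβ : 2 < β)
    {m : ℝ → ℝ} (hm : ∀ z, -1 < z → z ≤ 0 → |m z| ≤ 1) {z : ℝ}
    (hz : Gam α β ≤ z) (hz0 : z ≤ 0) (a b : ℕ) (ha : 1 ≤ a) (hb : 1 ≤ b) :
    |gg α β m a b z| ≤ (3 + β - α) * (a + b) := by
  have hG := (gam_facts hα hβ).1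
  have hb1 : (1 : ℝ) ≤ b := by exact_mod_cast hb
  have ha1 : (1 : ℝ) ≤ a := by exact_mod_cast ha
  have hy := gy_lt hα hβ ha hb hz
  have h1 := abs_le.1 (hm z (by linarith) hz0)
  have h2 := abs_le.1 (hm _ (lt_of_lt_of_le hG (z_ge hα hβ ha hb hz)) (z_le hα hβ ha hb hz))
  have h3 := Real.log_nonneg hy.le
  have h4 : Real.log (-gy α β a b z) ≤ 1 + b * β + a * (-α) := by
    refine le_trans (Real.log_le_log (by linarith) ?_) (log_growth hα hβ (a := a) (b := b))
    have := growth_le hα hβ (a := a) (b := b) hz hz0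
    have := neg_le_abs (gy α β a b z)
    have := abs_nonneg (gx β b z)
    linarith
  have h5 : 0 ≤ a * β := by nlinarith
  have h6 : 0 ≤ b * (-α) := by nlinarith
  unfold gg
  rw [abs_le]
  constructor <;> nlinarith [h1.1, h1.2, h2.1, h2.2]

lemma main_bound {α β : ℝ} (hα : α < -2) (hβ : 2 < β)
    {lam : ℝ} (hlam : Tendsto (fun N : ℕ =>
        ((N : ℝ))⁻¹ * ((2 : ℝ) ^ N)⁻¹ *
          ∑ i : Fin N → Fin 2,
            Real.log (nrm2 ((wordProd !![1, 0; α, 1] !![1, β; 0, 1] N i).mulVec ![0, 1])))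
      atTop (nhds lam))
    (m : ℝ → ℝ) (hm0 : m 0 = 0) (hm : ∀ z, -1 < z → z ≤ 0 → |m z| ≤ 1)
    (hmono : ∀ a b : ℕ, 1 ≤ a → 1 ≤ b → ∀ z w, Gam α β ≤ z → z ≤ w → w ≤ 0 →
      gg α β m a b z ≤ gg α β m a b w)
    (f g : ℕ → ℕ → ℝ)
    (hf : ∀ a b : ℕ, 1 ≤ a → 1 ≤ b → Real.log (f a b) = gg α β m a b (Gam α β))
    (hg : ∀ a b : ℕ, 1 ≤ a → 1 ≤ b → Real.log (g a b) = gg α β m a b 0) :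
    coneSum f ≤ 4 * lam ∧ 4 * lam ≤ coneSum g := by
  obtain ⟨hG1, hG0, -⟩ := gam_facts hα hβ
  have hC : 0 ≤ 3 + β - α := by linarith
  have hlam' : Tendsto (fun N : ℕ => (N : ℝ)⁻¹ *
      gE N (fun l => Real.log (nrm2 ![(gX α β l).1, (gX α β l).2]))) atTop (nhds lam) := by
    refine hlam.congr (fun N => ?_)
    rw [← gE_eq, mul_assoc]
    simp only [word_eq]
  have hinv : ∀ K : ℝ, Tendsto (fun N : ℕ => (N : ℝ)⁻¹ * K) atTop (nhds 0) := by
    intro K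
    have := (tendsto_inv_atTop_nhds_zero_nat (𝕜 := ℝ)).mul_const K
    simpa using this
  constructor
  · set T : ℕ → ℕ → ℝ := fun a b => gg α β m a b (Gam α β) with hTd
    have hT := gg_bd hα hβ hm (z := Gam α β) le_rfl hG0.le
    have hc := coneSum_eq_s6 (T := T) hT hf hC
    obtain ⟨K, hK⟩ := E_S (T := T) hT (c := coneSum f / 4) (by rw [hc]; ring) hC
    have hpt : ∀ l, gS T l + (fun _ => (-1 : ℝ)) l ≤
        Real.log (nrm2 ![(gX α β l).1, (gX α β l).2]) := by
      intro l
      obtain ⟨q, z, hq, hz1, hz2, hX, hz0, hS⟩ := inv_all hα hβ (m := m) (T := T) (s := 1) hm0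
        (fun a b ha hb z h1 h2 => by
          have := hmono a b ha hb _ z le_rfl h1 h2
          simp only [hTd]; linarith) l
      rw [hX]
      have h1 := nrm_ge hα hβ hq hz1 (gst_zero l)
      have h2 := abs_le.1 (hm z (by linarith) hz2)
      simp only
      linarith [h2.1, h2.2]
    have hlow : ∀ᶠ N : ℕ in atTop, coneSum f / 4 + (N : ℝ)⁻¹ * (-K - 1) ≤ (N : ℝ)⁻¹ *
      gE N (fun l => Real.log (nrm2 ![(gX α β l).1, (gX α β l).2])) := by
      filter_upwards [eventually_gt_atTop 0] with N hN
      have hN' : (0 : ℝ) < N := by exact_mod_cast hN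
      have h1 := gE_mono N _ _ hpt
      rw [gE_add, gE_const] at h1
      have h2 := abs_le.1 (hK N)
      have h3 : N * (coneSum f / 4) + (-K - 1) ≤
        gE N (fun l => Real.log (nrm2 ![(gX α β l).1, (gX α β l).2])) := by linarith [h2.1]
      have h4 := mul_le_mul_of_nonneg_left h3 (inv_pos.2 hN').le
      rw [mul_add, inv_mul_cancel_left₀ hN'.ne'] at h4
      exact h4
    have := le_of_tendsto_of_tendsto ((hinv (-K - 1)).const_add (coneSum f / 4)) hlam' hlow
    linarith
  · set T : ℕ → ℕ → ℝ := fun a b => gg α β m a b 0 with hTd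
    have hT := gg_bd hα hβ hm (z := 0) hG0.le le_rfl
    have hc := coneSum_eq_s6 (T := T) hT hg hC
    obtain ⟨K, hK⟩ := E_S (T := T) hT (c := coneSum g / 4) (by rw [hc]; ring) hC
    have hpt : ∀ l, Real.log (nrm2 ![(gX α β l).1, (gX α β l).2]) ≤
        gS T l + (fun l => (β - α) * gV (gst l) + 2) l := by
      intro l
      obtain ⟨q, z, hq, hz1, hz2, hX, hz0, hS⟩ := inv_all hα hβ (m := m) (T := T) (s := -1) hm0
        (fun a b ha hb z h1 h2 => by
          have := hmono a b ha hb z 0 h1 h2 le_rfl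
          simp only [hTd]; linarith) l
      rw [hX]
      have h1 := nrm_le hα hβ hq hz1 hz2 (gst_zero l)
      have h2 := abs_le.1 (hm z (by linarith) hz2)
      have h3 := mul_le_mul_of_nonneg_left (gV_ge (gst l)) (show 0 ≤ β - α by linarith)
      have hb : (0 : ℝ) ≤ (gst l).1 := Nat.cast_nonneg _
      have ha : (0 : ℝ) ≤ (gst l).2 := Nat.cast_nonneg _
      have h5 : 0 ≤ (gst l).2 * β := mul_nonneg ha (by linarith)
      have h6 : 0 ≤ (gst l).1 * (-α) := mul_nonneg hb (by linarith)
      simp only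
      linarith [h2.1, h2.2]
    have hup : ∀ᶠ N : ℕ in atTop, (N : ℝ)⁻¹ *
      gE N (fun l => Real.log (nrm2 ![(gX α β l).1, (gX α β l).2])) ≤
        coneSum g / 4 + (N : ℝ)⁻¹ * (K + (β - α) * 6 + 2) := by
      filter_upwards [eventually_gt_atTop 0] with N hN
      have hN' : (0 : ℝ) < N := by exact_mod_cast hN
      have h1 := gE_mono N _ _ hpt
      rw [gE_add, gE_add N (fun l => (β - α) * gV (gst l)) (fun _ => 2), gE_const, gE_mul] at h1
      have h2 := abs_le.1 (hK N)
      have h5 := mul_le_mul_of_nonneg_left (gE_V N) (show 0 ≤ β - α by linarith)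
      have h3 : gE N (fun l => Real.log (nrm2 ![(gX α β l).1, (gX α β l).2])) ≤
        N * (coneSum g / 4) + (K + (β - α) * 6 + 2) := by linarith [h2.2]
      have h4 := mul_le_mul_of_nonneg_left h3 (inv_pos.2 hN').le
      rw [mul_add, inv_mul_cancel_left₀ hN'.ne'] at h4
      exact h4
    have := le_of_tendsto_of_tendsto hlam'
      ((hinv (K + (β - α) * 6 + 2)).const_add (coneSum g / 4)) hup
    linarith

/-! ### The three norms -/

lemma gx_mono {α β : ℝ} (hα : α < -2) (hβ : 2 < β)
    {b : ℕ} {z w : ℝ} (h : z ≤ w) : gx β b z ≤ gx β b w := by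
  unfold gx; linarith

lemma gy_mono {α β : ℝ} (hα : α < -2) (hβ : 2 < β)
    {a b : ℕ} {z w : ℝ} (h : z ≤ w) : -gy α β a b z ≤ -gy α β a b w := by
  unfold gy gx
  have ha : (0 : ℝ) ≤ a := Nat.cast_nonneg _
  have haa : 0 ≤ a * (-α) := mul_nonneg ha (by linarith)
  nlinarith

lemma gg_inf {α β : ℝ} (hα : α < -2) (hβ : 2 < β)
    (a b : ℕ) (z : ℝ) :
    gg α β (fun _ => 0) a b z = Real.log (-gy α β a b z) := by
  simp [gg]

lemma gg_one {α β : ℝ} (hα : α < -2) (hβ : 2 < β)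
    {a b : ℕ} (ha : 1 ≤ a) (hb : 1 ≤ b) {z : ℝ} (hz : Gam α β ≤ z) (hz0 : z ≤ 0) :
    gg α β (fun z => Real.log (1 - z)) a b z =
      Real.log ((gx β b z - gy α β a b z) / (1 - z)) := by
  have hx := gx_gt hα hβ hb hz
  have hy := gy_lt hα hβ ha hb hz
  have hq := z_le hα hβ ha hb hz
  unfold gg
  rw [Real.log_div (by linarith) (by linarith), ← Real.log_mul (by linarith) (by linarith)]
  congr 2
  have : gy α β a b z ≠ 0 := by intro h; rw [h] at hy; linarith
  field_simp
  ring

lemma gg_two {α β : ℝ} (hα : α < -2) (hβ : 2 < β)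
    {a b : ℕ} (ha : 1 ≤ a) (hb : 1 ≤ b) {z : ℝ} (hz : Gam α β ≤ z) :
    gg α β (fun z => Real.log (1 + z ^ 2) / 2) a b z =
      Real.log (Real.sqrt ((gx β b z ^ 2 + gy α β a b z ^ 2) / (1 + z ^ 2))) := by
  have hx := gx_gt hα hβ hb hz
  have hy := gy_lt hα hβ ha hb hz
  have hy0 : gy α β a b z ≠ 0 := by intro h; rw [h] at hy; linarith
  unfold gg
  rw [Real.log_sqrt (by positivity), Real.log_div (by positivity) (by positivity)]
  have : gx β b z ^ 2 + gy α β a b z ^ 2 =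
      (-gy α β a b z) ^ 2 * (1 + (gx β b z / gy α β a b z) ^ 2) := by
    field_simp
    ring
  rw [this, Real.log_mul (by positivity) (by positivity), Real.log_pow]
  push_cast
  ring



theorem global_cone_bounds_rev (α β lam : ℝ) (hα : α < -2) (hβ : 2 < β)
    (hlam : Tendsto (fun N : ℕ =>
        ((N : ℝ))⁻¹ * ((2 : ℝ) ^ N)⁻¹ *
          ∑ i : Fin N → Fin 2,
            Real.log (nrm2 ((wordProd !![1, 0; α, 1] !![1, β; 0, 1] N i).mulVec ![0, 1])))
      atTop (nhds lam)) :
    max (max (coneSum (phit1 α β)) (coneSum (phit2 α β))) (coneSum (phitInf α β)) ≤ 4 * lam ∧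
      4 * lam ≤ min (min (coneSum (psit1 α β)) (coneSum (psit2 α β)))
        (coneSum (psitInf α β)) := by
  obtain ⟨hG1, hG0, -⟩ := gam_facts hα hβ
  have hInf := main_bound hα hβ hlam (fun _ => 0) rfl (by intros; simp)
    (by
      intro a b ha hb z w hz hzw hw
      rw [gg_inf hα hβ, gg_inf hα hβ]
      have := gy_lt hα hβ ha hb hz
      exact Real.log_le_log (by linarith) (gy_mono hα hβ hzw))
    (phitInf α β) (psitInf α β)
    (by
      intro a b ha hb
      rw [gg_inf hα hβ]
      congr 1
      unfold phitInf gy gx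
      ring)
    (by
      intro a b ha hb
      rw [gg_inf hα hβ]
      congr 1
      unfold psitInf gy gx
      ring)
  have hOne := main_bound hα hβ hlam (fun z => Real.log (1 - z)) (by simp)
    (by
      intro z h1 h2
      rw [abs_of_nonneg (Real.log_nonneg (by linarith))]
      have := Real.log_le_sub_one_of_pos (x := 1 - z) (by linarith)
      linarith)
    (by
      intro a b ha hb z w hz hzw hw
      rw [gg_one hα hβ ha hb hz (by linarith), gg_one hα hβ ha hb (by linarith) hw]
      have hx := gx_gt hα hβ hb hz
      have hy := gy_lt hα hβ ha hb hz
      have h1 := gx_mono hα hβ (b := b) hzw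
      have h2 := gy_mono hα hβ (a := a) (b := b) hzw
      apply Real.log_le_log
      · apply div_pos <;> linarith
      · apply div_le_div₀ <;> linarith)
    (phit1 α β) (psit1 α β)
    (by
      intro a b ha hb
      rw [gg_one hα hβ ha hb le_rfl hG0.le]
      congr 1
      unfold phit1 gy gx
      ring)
    (by
      intro a b ha hb
      rw [gg_one hα hβ ha hb hG0.le le_rfl]
      congr 1
      unfold psit1 gy gx
      ring)
  have hTwo := main_bound hα hβ hlam (fun z => Real.log (1 + z ^ 2) / 2) (by simp)
    (by
      intro z h1 h2
      have h3 : z ^ 2 ≤ 1 := by nlinarith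
      have h4 := Real.log_nonneg (x := 1 + z ^ 2) (by nlinarith [sq_nonneg z])
      rw [abs_of_nonneg (by positivity)]
      have := Real.log_le_sub_one_of_pos (x := 1 + z ^ 2) (by positivity)
      linarith)
    (by
      intro a b ha hb z w hz hzw hw
      rw [gg_two hα hβ ha hb hz, gg_two hα hβ ha hb (by linarith)]
      have hx := gx_gt hα hβ hb hz
      have hy := gy_lt hα hβ ha hb hz
      have h1 := gx_mono hα hβ (b := b) hzw
      have h2 := gy_mono hα hβ (a := a) (b := b) hzw
      apply Real.log_le_log
      · apply Real.sqrt_pos.2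
        have : 0 < gx β b z := by linarith
        positivity
      · apply Real.sqrt_le_sqrt
        apply div_le_div₀
        · positivity
        · nlinarith
        · positivity
        · nlinarith)
    (phit2 α β) (psit2 α β)
    (by
      intro a b ha hb
      rw [gg_two hα hβ ha hb le_rfl]
      unfold phit2 gy gx
      congr 3
      ring)
    (by
      intro a b ha hb
      rw [gg_two hα hβ ha hb hG0.le]
      unfold psit2 gy gx
      congr 2
      ring)
  exact ⟨max_le (max_le hOne.1 hTwo.1) hInf.1, le_min (le_min hOne.2 hTwo.2) hInf.2⟩

end
end

section
/- Let α < −2, β > 2 and Γ = −β/2 + ((β/2)² + β/α)^{1/2}. Then −1 < Γ < 0, and the cone C⁻ = {(u,v) ∈ ℝ² : v ≠ 0 and Γ ≤ u/v ≤ 0} is invariant under K_{ab} for all positive integers a, b: if v ≠ 0 and Γ ≤ u/v ≤ 0, then (u',v') = K_{ab}(u,v) = (u + bβv, aαu + (1+aαbβ)v) satisfies v' ≠ 0 and Γ ≤ u'/v' ≤ 0. -/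
/-- Lemma (negative-shear invariant cone): for `α < -2`, `β > 2` and
`Γ = -β/2 + √((β/2)² + β/α)`, one has `-1 < Γ < 0`, and the cone
`C⁻ = {(u,v) : v ≠ 0, Γ ≤ u/v ≤ 0}` is invariant under
`K_{ab}(u,v) = (u + bβv, aαu + (1 + aαbβ)v)` for all positive integers `a, b`. -/
theorem neg_cone_invariant (α β : ℝ) (hα : α < -2) (hβ : 2 < β) :
    -1 < -(β / 2) + Real.sqrt ((β / 2) ^ 2 + β / α) ∧
      -(β / 2) + Real.sqrt ((β / 2) ^ 2 + β / α) < 0 ∧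
      ∀ a b : ℕ, 1 ≤ a → 1 ≤ b → ∀ u v : ℝ, v ≠ 0 →
        -(β / 2) + Real.sqrt ((β / 2) ^ 2 + β / α) ≤ u / v → u / v ≤ 0 →
        (a * α * u + (1 + a * α * (b * β)) * v ≠ 0 ∧
          -(β / 2) + Real.sqrt ((β / 2) ^ 2 + β / α) ≤
            (u + b * β * v) / (a * α * u + (1 + a * α * (b * β)) * v) ∧
          (u + b * β * v) / (a * α * u + (1 + a * α * (b * β)) * v) ≤ 0) := by
  have hα0 : α ≠ 0 := by linarith
  have hba : -(β / 2) < β / α := by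
    rw [lt_div_iff_of_neg (by linarith)]
    nlinarith
  have hneg : β / α < 0 := div_neg_of_pos_of_neg (by linarith) (by linarith)
  have h1 : β / 2 - 1 < Real.sqrt ((β / 2) ^ 2 + β / α) := by
    apply Real.lt_sqrt_of_sq_lt
    nlinarith
  have h2 : Real.sqrt ((β / 2) ^ 2 + β / α) < β / 2 := by
    rw [Real.sqrt_lt' (by linarith)]
    linarith
  have hsq := Real.sq_sqrt (show 0 ≤ (β / 2) ^ 2 + β / α by nlinarith)
  obtain ⟨G, hG⟩ : ∃ G, G = -(β / 2) + Real.sqrt ((β / 2) ^ 2 + β / α) := ⟨_, rfl⟩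
  have hS : Real.sqrt ((β / 2) ^ 2 + β / α) = G + β / 2 := by linarith
  rw [← hG]
  rw [hS] at hsq h1 h2
  have hq : α * G * (G + β) = β := by
    have h3 : G * (G + β) = β / α := by linarith
    rw [mul_assoc, h3]
    field_simp
  have hG1 : -1 < G := by linarith
  have hG0 : G < 0 := by linarith
  refine ⟨hG1, hG0, ?_⟩
  intro a b ha hb u v hv hl hu
  have ha' : (1 : ℝ) ≤ a := by exact_mod_cast ha
  have hb' : (1 : ℝ) ≤ b := by exact_mod_cast hb
  obtain ⟨t, ht⟩ : ∃ t, t = u / v := ⟨_, rfl⟩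
  rw [← ht] at hl hu
  have hut : u = t * v := by rw [ht]; field_simp
  obtain ⟨s, hs⟩ : ∃ s, s = t + b * β := ⟨_, rfl⟩
  have hsG : G + β ≤ s := by nlinarith
  have hs1 : 1 < s := by linarith
  have hαG : 1 ≤ α * G := by
    by_contra h
    push Not at h
    nlinarith
  have has : s ≤ a * s := by nlinarith
  have hD : a * α * s + 1 < 0 := by nlinarith
  have e1 : a * α * u + (1 + a * α * (b * β)) * v = (a * α * s + 1) * v := by
    rw [hut, hs]; ring
  have e2 : u + b * β * v = s * v := by rw [hut, hs]; ring
  rw [e1, e2, mul_div_mul_right _ _ hv]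
  refine ⟨mul_ne_zero hD.ne hv, ?_, ?_⟩
  · rw [le_div_iff_of_neg hD]
    have h4 : α * G * s ≤ α * G * (a * s) := mul_le_mul_of_nonneg_left has (by linarith)
    have h5 : (α * G - 1) * (G + β) ≤ (α * G - 1) * s :=
      mul_le_mul_of_nonneg_left hsG (by linarith)
    linarith
  · exact div_nonpos_of_nonneg_of_nonpos (by linarith) hD.le
end
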